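/- arXiv:math/0509313 — 2 statements merged into one kernel-verified Lean document; each statement's English description precedes it below -/
import Mathlib

section
/- Let M = M^0(S; F(I), G(Lambda); P) be a Rees matrix semigroup with zero over a semigroupoid S. Suppose S is automatic and M is finitely generated (as a semigroup). Then M is an automatic semigroup. -/
/- Common framework: graphs, path languages, synchronous regularity,
   semigroupoids, automatic structures, and Rees matrix constructions. -/

namespace AutoRees

/-- Raw data of a semigroupoid: source and target maps on arrows together with a
totalised multiplication (whose values are only meaningful on composable pairs). -/
structure PreSgpd (O A : Type) where
  src : A → O
  tgt : A → O
  mul : A → A → A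

/-- A semigroupoid: the multiplication respects sources and targets and is
associative, on composable pairs. -/
structure Sgpd (O A : Type) extends PreSgpd O A where
  src_mul : ∀ e f, tgt e = src f → src (mul e f) = src e
  tgt_mul : ∀ e f, tgt e = src f → tgt (mul e f) = tgt f
  mul_assoc' : ∀ e f g, tgt e = src f → tgt f = src g →
    mul (mul e f) g = mul e (mul f g)

/-- Evaluate a nonempty word of edge labels as a product in the semigroupoid
(`none` on the empty word). -/
def evalPath? {O A E : Type} (S : PreSgpd O A) (lab : E → A) : List E → Option A
  | [] => none
  | e :: l => some ((l.map lab).foldl S.mul (lab e))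

/-- The consecutive-compatibility condition making a list of edges a path. -/
def IsPathChain {V E : Type} (esrc etgt : E → V) (l : List E) : Prop :=
  List.Chain' (fun e f => etgt e = esrc f) l

/-- The target of a non-empty path. -/
def pathTgt? {V E : Type} (etgt : E → V) (l : List E) : Option V :=
  l.getLast?.map etgt

/-- The source of a non-empty path. -/
def pathSrc? {V E : Type} (esrc : E → V) (l : List E) : Option V :=
  l.head?.map esrc

/-- A set of words is regular if it is a regular language in the usual sense. -/
def IsRegularSet {α : Type} (L : Set (List α)) : Prop :=
  Language.IsRegular (show Language α from L)

/-- The padding symbol used to pad a pair of paths, at the target of `l`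
(the letters of the padded alphabet `X^$` are `Sum.inl` (a genuine edge) or
`Sum.inr (some v)` (the padding edge at vertex `v`)). -/
def padSym {V E : Type} (etgt : E → V) (l : List E) : E ⊕ Option V :=
  Sum.inr (l.getLast?.map etgt)

/-- The padded convolution `(a, b) δ_X` of a pair of paths. -/
def deltaPair {V E : Type} (etgt : E → V) (a b : List E) :
    List ((E ⊕ Option V) × (E ⊕ Option V)) :=
  (a.map Sum.inl).zip (b.map Sum.inl) ++
    (if a.length ≤ b.length
      then (b.drop a.length).map (fun e => (padSym etgt a, Sum.inl e))
      else (a.drop b.length).map (fun e => (Sum.inl e, padSym etgt b)))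

/-- A binary relation on paths is synchronously regular if its image under the
padding map is a regular language over the padded product alphabet. -/
def SyncRegular {V E : Type} (etgt : E → V) (R : Set (List E × List E)) : Prop :=
  IsRegularSet { w | ∃ p ∈ R, w = deltaPair etgt p.1 p.2 }

/-- A choice of representatives `(X, K, ρ)` for a semigroupoid `S`: a graph `X`
with vertex set `S^0` (edge set `E`, source `esrc`, target `etgt`), a semigroupoid
morphism `ρ : X^+ → S` (induced by the edge-labelling `lab`), and a language `K`
of non-empty paths with `K ρ = S^1`. -/
structure ChoiceOfReps {O A : Type} (S : PreSgpd O A) (E : Type) where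
  esrc : E → O
  etgt : E → O
  lab : E → A
  lab_src : ∀ e, S.src (lab e) = esrc e
  lab_tgt : ∀ e, S.tgt (lab e) = etgt e
  K : Set (List E)
  K_path : ∀ l ∈ K, l ≠ [] ∧ IsPathChain esrc etgt l
  K_onto : ∀ a : A, ∃ l ∈ K, evalPath? S lab l = some a

variable {O A E : Type} {S : PreSgpd O A}

/-- The relation `K_=` = {(u,v) ∈ K × K : u ρ = v ρ}. -/
def relEq (C : ChoiceOfReps S E) : Set (List E × List E) :=
  { p | p.1 ∈ C.K ∧ p.2 ∈ C.K ∧ evalPath? S C.lab p.1 = evalPath? S C.lab p.2 }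

/-- The relation `K_a` for an edge `a` of `X`. -/
def relEdge (C : ChoiceOfReps S E) (a : E) : Set (List E × List E) :=
  { p | p.1 ∈ C.K ∧ p.2 ∈ C.K ∧ pathTgt? C.etgt p.1 = some (C.esrc a) ∧
        evalPath? S C.lab (p.1 ++ [a]) = evalPath? S C.lab p.2 }

/-- The relation `K_a` for a vertex `a` of `X` (regarded as the empty path at `a`). -/
def relVertex (C : ChoiceOfReps S E) (v : O) : Set (List E × List E) :=
  { p | p.1 ∈ C.K ∧ p.2 ∈ C.K ∧ pathTgt? C.etgt p.1 = some v ∧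
        evalPath? S C.lab p.1 = evalPath? S C.lab p.2 }

/-- An automatic structure: a finitely generated choice of representatives with
`K` regular such that `K_a` is synchronously regular for every edge and vertex. -/
def IsAutomaticStructure (C : ChoiceOfReps S E) : Prop :=
  Finite E ∧ IsRegularSet C.K ∧
    (∀ a : E, SyncRegular C.etgt (relEdge C a)) ∧
    (∀ v : O, SyncRegular C.etgt (relVertex C v))

/-- The set of non-empty prefixes of words in `K`. -/
def prefs {E : Type} (K : Set (List E)) : Set (List E) :=
  { p | p ≠ [] ∧ ∃ l ∈ K, p <+: l }

/-- The relation `K'_=` = {(u,v) ∈ K × Pref(K) : u ρ = v ρ}. -/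
def relPrefEq (C : ChoiceOfReps S E) : Set (List E × List E) :=
  { p | p.1 ∈ C.K ∧ p.2 ∈ prefs C.K ∧ evalPath? S C.lab p.1 = evalPath? S C.lab p.2 }

/-- A prefix-automatic structure. -/
def IsPrefixAutomaticStructure (C : ChoiceOfReps S E) : Prop :=
  IsAutomaticStructure C ∧ SyncRegular C.etgt (relPrefEq C)

/-- A cross-section: `ρ` restricted to `K` is injective. -/
def IsCrossSection (C : ChoiceOfReps S E) : Prop :=
  ∀ u ∈ C.K, ∀ v ∈ C.K, evalPath? S C.lab u = evalPath? S C.lab v → u = v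

/-- `K` is closed under taking non-empty prefixes. -/
def IsPrefixClosed (C : ChoiceOfReps S E) : Prop :=
  ∀ l ∈ C.K, ∀ p : List E, p ≠ [] → p <+: l → p ∈ C.K

/-- A semigroupoid (or semigroup, in the one-object case) is automatic if it
admits an automatic structure. -/
def IsAutomatic (S : PreSgpd O A) : Prop :=
  ∃ (E : Type) (C : ChoiceOfReps S E), IsAutomaticStructure C

/-- Prefix-automaticity. -/
def IsPrefixAutomatic (S : PreSgpd O A) : Prop :=
  ∃ (E : Type) (C : ChoiceOfReps S E), IsPrefixAutomaticStructure C

/-- Finite generation: every arrow is a (composable) product of arrows from some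
fixed finite set. -/
def IsFG (S : PreSgpd O A) : Prop :=
  ∃ T : Set A, T.Finite ∧ ∀ a : A, ∃ l : List A, l ≠ [] ∧ (∀ x ∈ l, x ∈ T) ∧
    IsPathChain S.src S.tgt l ∧ evalPath? S id l = some a

/-- An arrow is an identity if it acts as an identity on all composable products. -/
def IsIdentity (S : PreSgpd O A) (e : A) : Prop :=
  (∀ x, S.tgt e = S.src x → S.mul e x = x) ∧ (∀ y, S.tgt y = S.src e → S.mul y e = y)

/-- A small category is a semigroupoid with an identity arrow at every object. -/
def IsSmallCategory (S : PreSgpd O A) : Prop :=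
  ∀ v : O, ∃ e : A, S.src e = v ∧ S.tgt e = v ∧ IsIdentity S e

/-- No object is isolated. -/
def IsolationFree (S : PreSgpd O A) : Prop :=
  ∀ v : O, ∃ a : A, S.src a = v ∨ S.tgt a = v

namespace Rees

variable {O A I Λ : Type}

/-- A triple `(i, x, λ)` is valid if `i F = x α` and `x ω = λ G`. -/
def Valid (S : Sgpd O A) (F : I → O) (G : Λ → O) (t : I × A × Λ) : Prop :=
  F t.1 = S.src t.2.1 ∧ S.tgt t.2.1 = G t.2.2

/-- The set of valid Rees triples. -/
def Triples (S : Sgpd O A) (F : I → O) (G : Λ → O) : Type :=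
  { t : I × A × Λ // Valid S F G t }

theorem prod_valid (S : Sgpd O A) {F : I → O} {G : Λ → O}
    {i : I} {x : A} {lam : Λ} {j : I} {y : A} {mu : Λ} {p : A}
    (hx : Valid S F G (i, x, lam)) (hy : Valid S F G (j, y, mu))
    (hps : S.src p = G lam) (hpt : S.tgt p = F j) :
    Valid S F G (i, S.mul (S.mul x p) y, mu) := by
  obtain ⟨hx1, hx2⟩ := hx
  obtain ⟨hy1, hy2⟩ := hy
  have h1 : S.tgt x = S.src p := by rw [hps]; exact hx2
  have h2 : S.tgt p = S.src y := by rw [hpt]; exact hy1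
  have h3 : S.tgt (S.mul x p) = S.src y := by rw [S.tgt_mul x p h1]; exact h2
  constructor
  · show F i = S.src (S.mul (S.mul x p) y)
    rw [S.src_mul _ y h3, S.src_mul x p h1]; exact hx1
  · show S.tgt (S.mul (S.mul x p) y) = G mu
    rw [S.tgt_mul _ y h3]; exact hy2

/-- Data for a Rees matrix construction with zero over a semigroupoid `S`:
indexing functions `F`, `G` surjective onto the sets of sources and of targets
respectively, and a sandwich matrix `P` with entries in `S^1 ∪ {0}`
(`none` representing `0`) compatible with `F` and `G`. -/
structure Data0 (S : Sgpd O A) (I Λ : Type) where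
  F : I → O
  G : Λ → O
  P : Λ → I → Option A
  F_into : ∀ i, ∃ a : A, S.src a = F i
  F_onto : ∀ a : A, ∃ i, F i = S.src a
  G_into : ∀ lam, ∃ a : A, S.tgt a = G lam
  G_onto : ∀ a : A, ∃ lam, G lam = S.tgt a
  P_src : ∀ lam i p, P lam i = some p → S.src p = G lam
  P_tgt : ∀ lam i p, P lam i = some p → S.tgt p = F i

/-- Underlying set of the Rees matrix semigroup with zero (`none` is the zero). -/
def Carrier0 (S : Sgpd O A) (R : Data0 S I Λ) : Type :=
  Option (Triples S R.F R.G)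

/-- Multiplication of the Rees matrix semigroup with zero. -/
def mul0 (S : Sgpd O A) (R : Data0 S I Λ) :
    Carrier0 S R → Carrier0 S R → Carrier0 S R
  | some ⟨(i, x, lam), hx⟩, some ⟨(j, y, mu), hy⟩ =>
    match hp : R.P lam j with
    | some p => some ⟨(i, S.mul (S.mul x p) y, mu),
        prod_valid S hx hy (R.P_src lam j p hp) (R.P_tgt lam j p hp)⟩
    | none => none
  | none, _ => none
  | _, none => none

/-- The Rees matrix semigroup with zero `M^0(S; F(I), G(Λ); P)`, as a
one-object semigroupoid (i.e. a semigroup). -/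
def pre0 (S : Sgpd O A) (R : Data0 S I Λ) : PreSgpd Unit (Carrier0 S R) where
  src _ := ()
  tgt _ := ()
  mul := mul0 S R

/-- Data for a Rees matrix construction without zero (no zero entries in `P`). -/
structure Data (S : Sgpd O A) (I Λ : Type) where
  F : I → O
  G : Λ → O
  P : Λ → I → A
  F_into : ∀ i, ∃ a : A, S.src a = F i
  F_onto : ∀ a : A, ∃ i, F i = S.src a
  G_into : ∀ lam, ∃ a : A, S.tgt a = G lam
  G_onto : ∀ a : A, ∃ lam, G lam = S.tgt a
  P_src : ∀ lam i, S.src (P lam i) = G lam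
  P_tgt : ∀ lam i, S.tgt (P lam i) = F i

/-- Underlying set of the Rees matrix semigroup without zero. -/
def Carrier (S : Sgpd O A) (R : Data S I Λ) : Type :=
  Triples S R.F R.G

/-- Multiplication of the Rees matrix semigroup without zero. -/
def mul (S : Sgpd O A) (R : Data S I Λ) :
    Carrier S R → Carrier S R → Carrier S R
  | ⟨(i, x, lam), hx⟩, ⟨(j, y, mu), hy⟩ =>
    ⟨(i, S.mul (S.mul x (R.P lam j)) y, mu),
      prod_valid S hx hy (R.P_src lam j) (R.P_tgt lam j)⟩

/-- The Rees matrix semigroup without zero `M(S; F(I), G(Λ); P)`, as a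
one-object semigroupoid (i.e. a semigroup). -/
def pre (S : Sgpd O A) (R : Data S I Λ) : PreSgpd Unit (Carrier S R) where
  src _ := ()
  tgt _ := ()
  mul := mul S R

/-- The set `S P' S` of arrows of the form `s p t` with `p` a non-zero entry of `P`. -/
def SPS0 (S : Sgpd O A) (R : Data0 S I Λ) : Set A :=
  { a | ∃ s p t lam i, R.P lam i = some p ∧ S.tgt s = S.src p ∧ S.tgt p = S.src t ∧
        a = S.mul (S.mul s p) t }

/-- The set `S P S` for a matrix without zero entries. -/
def SPS (S : Sgpd O A) (R : Data S I Λ) : Set A :=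
  { a | ∃ s t lam i, S.tgt s = S.src (R.P lam i) ∧ S.tgt (R.P lam i) = S.src t ∧
        a = S.mul (S.mul s (R.P lam i)) t }

/-- The set of targets of arrows of `S` (the codomain of `G`). -/
def tgtSet (S : Sgpd O A) : Set O := { v | ∃ a : A, S.tgt a = v }

/-- `T` is strongly right-ideal-generated by a row cross-section of `P`. -/
def StronglyRIG0 (S : Sgpd O A) (R : Data0 S I Λ) (T : Set A) : Prop :=
  ∃ Λ' : Set Λ, Set.BijOn R.G Λ' (tgtSet S) ∧
    ∀ t ∈ T, ∃ lam ∈ Λ', ∃ i p s, R.P lam i = some p ∧ S.tgt p = S.src s ∧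
      t = S.mul p s

/-- `T` is weakly right-ideal-generated by a row cross-section of `P`. -/
def WeaklyRIG0 (S : Sgpd O A) (R : Data0 S I Λ) (T : Set A) : Prop :=
  ∃ Λ' : Set Λ, Set.BijOn R.G Λ' (tgtSet S) ∧
    ∀ t ∈ T, ∃ lam ∈ Λ', ∃ i p, R.P lam i = some p ∧
      (t = p ∨ ∃ s, S.tgt p = S.src s ∧ t = S.mul p s)

/-- Weak right-ideal generation, for a matrix without zero entries. -/
def WeaklyRIG (S : Sgpd O A) (R : Data S I Λ) (T : Set A) : Prop :=
  ∃ Λ' : Set Λ, Set.BijOn R.G Λ' (tgtSet S) ∧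
    ∀ t ∈ T, ∃ lam ∈ Λ', ∃ i,
      (t = R.P lam i ∨ ∃ s, S.tgt (R.P lam i) = S.src s ∧ t = S.mul (R.P lam i) s)

end Rees


end AutoRees

namespace AutoRees
/-! ### Closure properties of regular languages -/
section Reg

theorem reg_of_family {α σ : Type} [Finite σ] (F : σ → Set (List α)) (step : σ → α → σ)
    (h : ∀ q a w, (a :: w) ∈ F q ↔ w ∈ F (step q a)) (q : σ) : IsRegularSet (F q) := by
  classical
  have := Fintype.ofFinite σ
  refine ⟨σ, inferInstance, ⟨step, q, {q | [] ∈ F q}⟩, ?_⟩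
  have key : ∀ (w : List α) (p : σ), (w.foldl step p) ∈ {q | [] ∈ F q} ↔ w ∈ F p := by
    intro w
    induction w with
    | nil => intro p; rfl
    | cons a w ih => intro p; rw [h]; exact ih _
  exact Set.ext fun w => key w q

theorem reg_of_nfamily {α σ : Type} [Finite σ] (F : σ → Set (List α)) (step : σ → α → Set σ)
    (h : ∀ q a w, (a :: w) ∈ F q ↔ ∃ p ∈ step q a, w ∈ F p) (q : σ) : IsRegularSet (F q) := by
  have := reg_of_family (σ := Set σ) (fun Q => {w | ∃ q ∈ Q, w ∈ F q})
    (fun Q a => {p | ∃ q ∈ Q, p ∈ step q a}) (by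
      intro Q a w
      simp only [Set.mem_ofPred_eq, h]
      constructor
      · rintro ⟨q, hq, p, hp, hw⟩; exact ⟨p, ⟨q, hq, hp⟩, hw⟩
      · rintro ⟨p, ⟨q, hq, hp⟩, hw⟩; exact ⟨q, hq, p, hp, hw⟩) {q}
  simpa using this

theorem reg_family {α : Type} {L : Set (List α)} (h : IsRegularSet L) :
    ∃ (σ : Type) (_ : Finite σ) (F : σ → Set (List α)) (step : σ → α → σ) (q : σ),
      (∀ q a w, (a :: w) ∈ F q ↔ w ∈ F (step q a)) ∧ F q = L := by
  obtain ⟨σ, _, M, hM⟩ := h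
  refine ⟨σ, inferInstance, fun q => M.acceptsFrom q, M.step, M.start, ?_, hM⟩
  intro q a w
  rfl

theorem family_append {α σ : Type} {F : σ → Set (List α)} {step : σ → α → σ}
    (h : ∀ q a w, (a :: w) ∈ F q ↔ w ∈ F (step q a)) (x w : List α) (q : σ) :
    x ++ w ∈ F q ↔ w ∈ F (x.foldl step q) := by
  induction x generalizing q with
  | nil => rfl
  | cons a x ih => rw [List.cons_append, h, ih]; rfl

theorem reg_inter {α : Type} {L M : Set (List α)} (h1 : IsRegularSet L) (h2 : IsRegularSet M) :
    IsRegularSet (L ∩ M) := Language.IsRegular.inf h1 h2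

theorem reg_union {α : Type} {L M : Set (List α)} (h1 : IsRegularSet L) (h2 : IsRegularSet M) :
    IsRegularSet (L ∪ M) := Language.IsRegular.add h1 h2

theorem reg_empty {α : Type} : IsRegularSet (∅ : Set (List α)) :=
  reg_of_family (σ := Unit) (fun _ => ∅) (fun _ _ => ()) (by simp) ()

theorem reg_iUnion {α ι : Type} [Finite ι] {L : ι → Set (List α)} (h : ∀ i, IsRegularSet (L i)) :
    IsRegularSet (⋃ i, L i) := by
  classical
  have := Fintype.ofFinite ι
  have key : ∀ s : Finset ι, IsRegularSet (⋃ i ∈ s, L i) := by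
    intro s
    induction s using Finset.induction_on with
    | empty => simpa using reg_empty
    | insert a s _ ih => rw [Finset.set_biUnion_insert]; exact reg_union (h a) ih
  simpa using key Finset.univ

theorem reg_map {α β : Type} (f : α → β) {L : Set (List α)} (h : IsRegularSet L) :
    IsRegularSet (List.map f '' L) := by
  obtain ⟨σ, _, F, step, q, hF, rfl⟩ := reg_family h
  refine reg_of_nfamily (fun q => List.map f '' F q) (fun q b => {p | ∃ a, f a = b ∧ step q a = p})
    ?_ q
  intro q b w
  constructor
  · rintro ⟨l, hl, he⟩
    cases l with
    | nil => simp at he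
    | cons a l =>
      simp only [List.map_cons, List.cons.injEq] at he
      exact ⟨_, ⟨a, he.1, rfl⟩, l, (hF _ _ _).1 hl, he.2⟩
  · rintro ⟨p, ⟨a, ha, rfl⟩, l, hl, rfl⟩
    exact ⟨a :: l, (hF _ _ _).2 hl, by simp [ha]⟩

theorem reg_flatMap {α β : Type} (φ : β → List α) {L : Set (List α)} (h : IsRegularSet L) :
    IsRegularSet {w : List β | w.flatMap φ ∈ L} := by
  obtain ⟨σ, _, F, step, q, hF, rfl⟩ := reg_family h
  refine reg_of_family (fun q => {w : List β | w.flatMap φ ∈ F q})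
    (fun q b => (φ b).foldl step q) ?_ q
  intro q b w
  simp only [Set.mem_ofPred_eq, List.flatMap_cons]
  exact family_append hF _ _ _

theorem reg_comap {α β : Type} (f : β → α) {L : Set (List α)} (h : IsRegularSet L) :
    IsRegularSet {w : List β | w.map f ∈ L} := by
  obtain ⟨σ, _, F, step, q, hF, rfl⟩ := reg_family h
  exact reg_of_family (fun q => {w : List β | w.map f ∈ F q})
    (fun q b => step q (f b)) (fun q b w => hF _ _ _) q

theorem reg_pad {α : Type} (a : α) {L : Set (List α)} (h : IsRegularSet L) :
    IsRegularSet {w | ∃ y ∈ L, ∃ k, w = y ++ List.replicate k a} := by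
  obtain ⟨σ, _, F, step, q, hF, rfl⟩ := reg_family h
  let G : Option σ → Set (List α) := fun q => match q with
    | some q => {w | ∃ y ∈ F q, ∃ k, w = y ++ List.replicate k a}
    | none => {w | ∃ k, w = List.replicate k a}
  refine reg_of_nfamily G (fun q b => match q with
    | some q => {p | p = some (step q b) ∨ (b = a ∧ [] ∈ F q ∧ p = none)}
    | none => {p | b = a ∧ p = none}) ?_ (some q)
  intro q b w
  cases q with
  | none =>
    simp only [G, Set.mem_ofPred_eq]
    constructor
    · rintro ⟨k, hk⟩
      cases k with
      | zero => simp at hk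
      | succ k =>
        simp only [List.replicate_succ, List.cons.injEq] at hk
        exact ⟨none, ⟨hk.1, rfl⟩, k, hk.2⟩
    · rintro ⟨_, ⟨rfl, rfl⟩, k, rfl⟩
      exact ⟨k + 1, rfl⟩
  | some q =>
    simp only [G, Set.mem_ofPred_eq]
    constructor
    · rintro ⟨y, hy, k, hk⟩
      cases y with
      | nil =>
        cases k with
        | zero => simp at hk
        | succ k =>
          simp only [List.nil_append, List.replicate_succ, List.cons.injEq] at hk
          exact ⟨none, Or.inr ⟨hk.1, hy, rfl⟩, k, hk.2⟩
      | cons c y =>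
        simp only [List.cons_append, List.cons.injEq] at hk
        obtain ⟨rfl, rfl⟩ := hk
        exact ⟨_, Or.inl rfl, y, (hF _ _ _).1 hy, k, rfl⟩
    · rintro ⟨p, rfl | ⟨rfl, hn, rfl⟩, hw⟩
      · obtain ⟨y, hy, k, rfl⟩ := hw
        exact ⟨b :: y, (hF _ _ _).2 hy, k, rfl⟩
      · obtain ⟨k, rfl⟩ := hw
        exact ⟨[], hn, k + 1, rfl⟩

theorem reg_unpad {α : Type} (a : α) {L : Set (List α)} (h : IsRegularSet L) :
    IsRegularSet {w | ∃ k, w ++ List.replicate k a ∈ L} := by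
  obtain ⟨σ, _, F, step, q, hF, rfl⟩ := reg_family h
  refine reg_of_family (fun q => {w | ∃ k, w ++ List.replicate k a ∈ F q}) step ?_ q
  intro q b w
  simp only [Set.mem_ofPred_eq, List.cons_append, hF]

theorem reg_notMem {α : Type} (a : α) : IsRegularSet {w : List α | a ∉ w} := by
  classical
  let G : Bool → Set (List α) := fun q => match q with
    | true => {w | a ∉ w}
    | false => ∅
  refine reg_of_family G (fun q b => q && decide (a ≠ b)) ?_ true
  intro q b w
  cases q with
  | false => simp [G]
  | true =>
    by_cases hb : a = b
    · simp [G, hb]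
    · simp [G, hb]

theorem reg_singleton {α : Type} (a : α) : IsRegularSet {([a] : List α)} := by
  classical
  let G : Option Bool → Set (List α) := fun q => match q with
    | some true => {[a]}
    | some false => {[]}
    | none => ∅
  refine reg_of_family G (fun q b => if q = some true ∧ b = a then some false else none) ?_
    (some true)
  intro q b w
  rcases q with _ | _ | _
  · simp [G]
  · simp [G]
  · by_cases hb : b = a
    · simp [G, hb]
    · simp [G, hb]

end Reg

/-! ### Padded words and automatic relations -/
section Pads

/-- `x` is the word `u` followed by padding. -/
def Pads {E : Type} (u : List E) (x : List (Option E)) : Prop :=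
  ∃ k, x = u.map some ++ List.replicate k none

theorem Pads.snoc {E : Type} {u : List E} {x : List (Option E)} :
    Pads u (x ++ [none]) ↔ Pads u x := by
  constructor
  · rintro ⟨k, hk⟩
    cases k with
    | zero =>
      have : (none : Option E) ∈ u.map some := by
        simp only [List.replicate_zero, List.append_nil] at hk
        rw [← hk]; simp
      simp at this
    | succ k =>
      rw [List.replicate_succ', ← List.append_assoc] at hk
      exact ⟨k, (List.append_inj' hk rfl).1⟩
  · rintro ⟨k, rfl⟩
    exact ⟨k + 1, by rw [List.replicate_succ', ← List.append_assoc]⟩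

theorem Pads.append {E : Type} {u : List E} {x : List (Option E)} (k : ℕ) :
    Pads u (x ++ List.replicate k none) ↔ Pads u x := by
  induction k with
  | zero => simp
  | succ k ih => rw [List.replicate_succ', ← List.append_assoc, Pads.snoc, ih]

theorem Pads.reduce {E : Type} {u : List E} {x : List (Option E)} (h : Pads u x) :
    x.reduceOption = u := by
  obtain ⟨k, rfl⟩ := h
  have : (List.replicate k (none : Option E)).reduceOption = [] := by
    induction k with
    | zero => rfl
    | succ k ih => rw [List.replicate_succ, List.reduceOption_cons_of_none, ih]
  rw [List.reduceOption_append, this]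
  simp [List.reduceOption, List.filterMap_map]

theorem Pads.unique {E : Type} {u v : List E} {x : List (Option E)} (h : Pads u x)
    (h' : Pads v x) : u = v := h.reduce.symm.trans h'.reduce

theorem Pads.eq_of_length {E : Type} {u : List E} {x y : List (Option E)} (h : Pads u x)
    (h' : Pads u y) (hl : x.length = y.length) : x = y := by
  obtain ⟨k, rfl⟩ := h
  obtain ⟨l, rfl⟩ := h'
  simp at hl
  rw [hl]

theorem Pads.le {E : Type} {u : List E} {x : List (Option E)} (h : Pads u x) :
    u.length ≤ x.length := by
  obtain ⟨k, rfl⟩ := h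
  simp

theorem Pads.exists_length {E : Type} (u : List E) (n : ℕ) (h : u.length ≤ n) :
    ∃ x, Pads u x ∧ x.length = n :=
  ⟨_, ⟨n - u.length, rfl⟩, by simp; omega⟩

theorem pair_ext {α β : Type} {c d : List (α × β)} (h1 : c.map Prod.fst = d.map Prod.fst)
    (h2 : c.map Prod.snd = d.map Prod.snd) : c = d := by
  induction c generalizing d with
  | nil => cases d <;> simp_all
  | cons a c ih =>
    cases d with
    | nil => simp at h1
    | cons b d =>
      simp only [List.map_cons, List.cons.injEq] at h1 h2
      rw [ih h1.2 h2.2, Prod.ext h1.1 h2.1]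

/-- The padded language of a relation. -/
def relLang {E : Type} (R : Set (List E × List E)) : Set (List (Option E × Option E)) :=
  {c | ∃ p ∈ R, Pads p.1 (c.map Prod.fst) ∧ Pads p.2 (c.map Prod.snd)}

/-- Relations with regular padded language. -/
def AutoRel {E : Type} (R : Set (List E × List E)) : Prop := IsRegularSet (relLang R)

theorem AutoRel.union {E : Type} {R T : Set (List E × List E)} (hR : AutoRel R) (hT : AutoRel T) :
    AutoRel (R ∪ T) := by
  have := reg_union hR hT
  unfold AutoRel
  convert this using 1
  ext c
  simp only [relLang, Set.mem_union, Set.mem_ofPred_eq]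
  constructor
  · rintro ⟨p, hp | hp, h⟩
    · exact Or.inl ⟨p, hp, h⟩
    · exact Or.inr ⟨p, hp, h⟩
  · rintro (⟨p, hp, h⟩ | ⟨p, hp, h⟩)
    · exact ⟨p, Or.inl hp, h⟩
    · exact ⟨p, Or.inr hp, h⟩

theorem AutoRel.iUnion {E ι : Type} [Finite ι] {R : ι → Set (List E × List E)}
    (hR : ∀ i, AutoRel (R i)) : AutoRel (⋃ i, R i) := by
  have := reg_iUnion hR
  unfold AutoRel
  convert this using 1
  ext c
  simp only [relLang, Set.mem_iUnion, Set.mem_ofPred_eq]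
  constructor
  · rintro ⟨p, ⟨i, hp⟩, h⟩; exact ⟨i, p, hp, h⟩
  · rintro ⟨i, p, hp, h⟩; exact ⟨p, ⟨i, hp⟩, h⟩

theorem AutoRel.empty {E : Type} : AutoRel (∅ : Set (List E × List E)) := by
  have := reg_empty (α := Option E × Option E)
  unfold AutoRel
  convert this using 1
  ext c
  simp [relLang]

/-- The padded words of a language form a regular language. -/
theorem reg_pads {E : Type} {L : Set (List E)} (h : IsRegularSet L) :
    IsRegularSet {x | ∃ u ∈ L, Pads u x} := by
  have := reg_pad (none : Option E) (reg_map some h)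
  convert this using 1
  ext c
  simp [Pads]

theorem AutoRel.prod {E : Type} {L M : Set (List E)} (hL : IsRegularSet L) (hM : IsRegularSet M) :
    AutoRel (L ×ˢ M) := by
  have := reg_inter (reg_comap (Prod.fst : Option E × Option E → _) (reg_pads hL))
    (reg_comap (Prod.snd : Option E × Option E → _) (reg_pads hM))
  unfold AutoRel
  convert this using 1
  ext c
  simp only [relLang, Set.mem_ofPred_eq, Set.mem_inter_iff]
  constructor
  · rintro ⟨p, ⟨h1, h2⟩, h3, h4⟩; exact ⟨⟨_, h1, h3⟩, _, h2, h4⟩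
  · rintro ⟨⟨u, h1, h3⟩, v, h2, h4⟩; exact ⟨(u, v), ⟨h1, h2⟩, h3, h4⟩

theorem AutoRel.comp {E : Type} {R T : Set (List E × List E)} (hR : AutoRel R) (hT : AutoRel T) :
    AutoRel {p | ∃ v, (p.1, v) ∈ R ∧ (v, p.2) ∈ T} := by
  have h1 := reg_inter
    (reg_comap (fun t : Option E × Option E × Option E => (t.1, t.2.1)) hR)
    (reg_comap (fun t : Option E × Option E × Option E => (t.2.1, t.2.2)) hT)
  have h2 := reg_unpad (none, none) (reg_map (fun t => (t.1, t.2.2)) h1)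
  unfold AutoRel
  convert h2 using 1
  ext c
  simp only [relLang, Set.mem_ofPred_eq, Set.mem_image, Set.mem_inter_iff, List.map_map]
  constructor
  · rintro ⟨⟨u, w⟩, ⟨v, huv, hvw⟩, hu, hw⟩
    obtain ⟨y, hy, hyl⟩ := Pads.exists_length v (c.length + v.length) (by omega)
    let c' := c ++ List.replicate v.length (none, none)
    have hl : c'.length = y.length := by simp [c', hyl]
    refine ⟨v.length, List.zipWith (fun a b => (a.1, b, a.2)) c' y, ⟨?_, ?_⟩, ?_⟩
    · refine ⟨(u, v), huv, ?_, ?_⟩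
      · have : List.map (Prod.fst ∘ fun t : Option E × Option E × Option E => (t.1, t.2.1))
          (List.zipWith (fun a b => (a.1, b, a.2)) c' y) = c'.map Prod.fst := by
          rw [List.map_zipWith]
          apply List.ext_getElem <;> simp [hl]
        rw [this]
        simp only [c', List.map_append, List.map_replicate]
        exact (Pads.append _).2 hu
      · have : List.map (Prod.snd ∘ fun t : Option E × Option E × Option E => (t.1, t.2.1))
          (List.zipWith (fun a b => (a.1, b, a.2)) c' y) = y := by
          rw [List.map_zipWith]
          apply List.ext_getElem <;> simp [hl]
        rw [this]; exact hy
    · refine ⟨(v, w), hvw, ?_, ?_⟩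
      · have : List.map (Prod.fst ∘ fun t : Option E × Option E × Option E => (t.2.1, t.2.2))
          (List.zipWith (fun a b => (a.1, b, a.2)) c' y) = y := by
          rw [List.map_zipWith]
          apply List.ext_getElem <;> simp [hl]
        rw [this]; exact hy
      · have : List.map (Prod.snd ∘ fun t : Option E × Option E × Option E => (t.2.1, t.2.2))
          (List.zipWith (fun a b => (a.1, b, a.2)) c' y) = c'.map Prod.snd := by
          rw [List.map_zipWith]
          apply List.ext_getElem <;> simp [hl]
        rw [this]
        simp only [c', List.map_append, List.map_replicate]
        exact (Pads.append _).2 hw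
    · rw [List.map_zipWith]
      apply List.ext_getElem <;> simp [hl, c']
  · rintro ⟨k, t, ⟨⟨⟨u, v⟩, huv, hu, hv⟩, ⟨v', w⟩, hvw, hv', hw⟩, ht⟩
    have : v = v' := Pads.unique hv hv'
    subst this
    refine ⟨(u, w), ⟨v, huv, hvw⟩, ?_, ?_⟩
    · rw [← Pads.append k]
      have := congrArg (List.map Prod.fst) ht
      simp only [List.map_append, List.map_replicate, List.map_map] at this
      rw [← this]; exact hu
    · rw [← Pads.append k]
      have := congrArg (List.map Prod.snd) ht
      simp only [List.map_append, List.map_replicate, List.map_map] at this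
      rw [← this]; exact hw

/-- Forget the padding annotations. -/
def unsym {V E : Type} (p : (E ⊕ Option V) × (E ⊕ Option V)) : Option E × Option E :=
  (p.1.getLeft?, p.2.getLeft?)

theorem delta_fst {V E : Type} (etgt : E → V) (a b : List E) :
    Pads a (((deltaPair etgt a b).map unsym).map Prod.fst) := by
  unfold deltaPair
  split_ifs with h
  · refine ⟨b.length - a.length, ?_⟩
    simp only [List.map_append, List.map_map, List.zip_map, List.map_drop]
    congr 1
    · apply List.ext_getElem <;> simp [unsym, h]
    · apply List.ext_getElem <;> simp [unsym, padSym]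
  · refine ⟨0, ?_⟩
    apply List.ext_getElem
    · simp; omega
    · intro n h1 h2
      simp [List.getElem_append, unsym]
      split_ifs <;> simp
      congr 1; omega

theorem delta_snd {V E : Type} (etgt : E → V) (a b : List E) :
    Pads b (((deltaPair etgt a b).map unsym).map Prod.snd) := by
  unfold deltaPair
  split_ifs with h
  · refine ⟨0, ?_⟩
    apply List.ext_getElem
    · simp; omega
    · intro n h1 h2
      simp [List.getElem_append, unsym]
      split_ifs <;> simp
      congr 1; omega
  · refine ⟨a.length - b.length, ?_⟩
    simp only [List.map_append, List.map_map, List.zip_map, List.map_drop]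
    congr 1
    · apply List.ext_getElem <;> simp [unsym]; omega
    · apply List.ext_getElem <;> simp [unsym, padSym]

theorem delta_length {V E : Type} (etgt : E → V) (a b : List E) :
    (deltaPair etgt a b).length = max a.length b.length := by
  unfold deltaPair
  split_ifs with h <;> simp <;> omega

theorem relLang_eq {V E : Type} (etgt : E → V) (R : Set (List E × List E)) :
    relLang R = {c | ∃ y ∈ List.map unsym '' {w | ∃ p ∈ R, w = deltaPair etgt p.1 p.2},
      ∃ k, c = y ++ List.replicate k (none, none)} := by
  ext c
  simp only [relLang, Set.mem_ofPred_eq, Set.mem_image]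
  constructor
  · rintro ⟨p, hp, h1, h2⟩
    refine ⟨_, ⟨_, ⟨p, hp, rfl⟩, rfl⟩, c.length - max p.1.length p.2.length, ?_⟩
    have l1 := h1.le
    have l2 := h2.le
    simp only [List.length_map] at l1 l2
    apply pair_ext
    · apply h1.eq_of_length
      · simp only [List.map_append, List.map_replicate]
        exact (Pads.append _).2 (delta_fst _ _ _)
      · simp [delta_length]; omega
    · apply h2.eq_of_length
      · simp only [List.map_append, List.map_replicate]
        exact (Pads.append _).2 (delta_snd _ _ _)
      · simp [delta_length]; omega
  · rintro ⟨_, ⟨_, ⟨p, hp, rfl⟩, rfl⟩, k, rfl⟩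
    refine ⟨p, hp, ?_, ?_⟩
    · rw [List.map_append, List.map_replicate]
      exact (Pads.append _).2 (delta_fst _ _ _)
    · rw [List.map_append, List.map_replicate]
      exact (Pads.append _).2 (delta_snd _ _ _)

theorem autoRel_of_sync {V E : Type} {etgt : E → V} {R : Set (List E × List E)}
    (h : SyncRegular etgt R) : AutoRel R := by
  unfold AutoRel
  rw [relLang_eq etgt]
  exact reg_pad _ (reg_map _ h)

/-- Insert padding annotations over one vertex. -/
def resym {E : Type} (p : Option E × Option E) : (E ⊕ Option Unit) × (E ⊕ Option Unit) :=
  (p.1.elim (Sum.inr (some ())) Sum.inl, p.2.elim (Sum.inr (some ())) Sum.inl)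

theorem delta_no_pad {V E : Type} (etgt : E → V) (a b : List E) :
    (none, none) ∉ (deltaPair etgt a b).map unsym := by
  unfold deltaPair
  split_ifs with h
  · simp only [List.map_append, List.mem_append, not_or]
    constructor
    · intro hm
      obtain ⟨⟨x, y⟩, hx, hy⟩ := List.mem_map.1 hm
      obtain ⟨z, hz, rfl⟩ := List.mem_map.1 (List.of_mem_zip hx).1
      simp [unsym] at hy
    · intro hm
      obtain ⟨z, hz, hy⟩ := List.mem_map.1 hm
      obtain ⟨e, he, rfl⟩ := List.mem_map.1 hz
      simp [unsym] at hy
  · simp only [List.map_append, List.mem_append, not_or]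
    constructor
    · intro hm
      obtain ⟨⟨x, y⟩, hx, hy⟩ := List.mem_map.1 hm
      obtain ⟨z, hz, rfl⟩ := List.mem_map.1 (List.of_mem_zip hx).1
      simp [unsym] at hy
    · intro hm
      obtain ⟨z, hz, hy⟩ := List.mem_map.1 hm
      obtain ⟨e, he, rfl⟩ := List.mem_map.1 hz
      simp [unsym] at hy

theorem resym_unsym {E : Type} (etgt : E → Unit) (a b : List E) (ha : a ≠ []) (hb : b ≠ []) :
    ((deltaPair etgt a b).map unsym).map resym = deltaPair etgt a b := by
  rw [List.map_map]
  conv_rhs => rw [← List.map_id (deltaPair etgt a b)]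
  apply List.map_congr_left
  rintro ⟨x, y⟩ h
  unfold deltaPair at h
  rw [List.mem_append] at h
  rcases h with h | h
  · obtain ⟨z, hz, rfl⟩ := List.mem_map.1 (List.of_mem_zip h).1
    obtain ⟨z', hz, rfl⟩ := List.mem_map.1 (List.of_mem_zip h).2
    rfl
  · split_ifs at h
    · obtain ⟨e, he, h⟩ := List.mem_map.1 h
      obtain ⟨rfl, rfl⟩ := Prod.mk.inj h
      simp [padSym, List.getLast?_eq_getLast_of_ne_nil ha, unsym, resym]
    · obtain ⟨e, he, h⟩ := List.mem_map.1 h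
      obtain ⟨rfl, rfl⟩ := Prod.mk.inj h
      simp [padSym, List.getLast?_eq_getLast_of_ne_nil hb, unsym, resym]

theorem sync_of_autoRel {E : Type} {etgt : E → Unit} {R : Set (List E × List E)}
    (h : AutoRel R) (hne : ∀ p ∈ R, p.1 ≠ [] ∧ p.2 ≠ []) : SyncRegular etgt R := by
  have := reg_map resym (reg_inter h (reg_notMem (none, none)))
  unfold SyncRegular
  convert this using 1
  rw [relLang_eq etgt]
  ext w
  simp only [Set.mem_ofPred_eq, Set.mem_image, Set.mem_inter_iff]
  constructor
  · rintro ⟨p, hp, rfl⟩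
    exact ⟨_, ⟨⟨_, ⟨_, ⟨p, hp, rfl⟩, rfl⟩, 0, by simp⟩, delta_no_pad _ _ _⟩,
      resym_unsym _ _ _ (hne p hp).1 (hne p hp).2⟩
  · rintro ⟨c, ⟨⟨_, ⟨_, ⟨p, hp, rfl⟩, rfl⟩, k, rfl⟩, hk⟩, rfl⟩
    refine ⟨p, hp, ?_⟩
    have : k = 0 := by
      by_contra hk0
      exact hk (by simp [hk0])
    subst this
    simp only [List.replicate_zero, List.append_nil]
    exact resym_unsym _ _ _ (hne p hp).1 (hne p hp).2

end Pads
end AutoRees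

namespace AutoRees
/-! ### The monoid obtained by adjoining a zero and an identity -/
section Zt

/-- Arrows of `S` with a zero and an identity adjoined. -/
inductive Zt {O A : Type} (S : Sgpd O A) : Type
  | zero : Zt S
  | one : Zt S
  | arr (a : A) : Zt S

variable {O A : Type} {S : Sgpd O A}

open Classical in
/-- Multiplication on `Zt S`. -/
noncomputable def Zt.mul' : Zt S → Zt S → Zt S
  | .one, y => y
  | x, .one => x
  | .arr a, .arr b => if S.tgt a = S.src b then .arr (S.mul a b) else .zero
  | .zero, _ => .zero
  | _, .zero => .zero

theorem Zt.mul'_assoc (x y z : Zt S) : (x.mul' y).mul' z = x.mul' (y.mul' z) := by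
  rcases x with _ | _ | a
  · rcases y with _ | _ | b <;> rcases z with _ | _ | c <;> simp only [Zt.mul'] <;>
      (split_ifs <;> rfl)
  · rcases y with _ | _ | b <;> rcases z with _ | _ | c <;> simp only [Zt.mul']
  · rcases y with _ | _ | b
    · rcases z with _ | _ | c <;> simp only [Zt.mul']
    · rcases z with _ | _ | c <;> simp only [Zt.mul']
    · rcases z with _ | _ | c
      · simp only [Zt.mul']; split_ifs <;> rfl
      · simp only [Zt.mul']; split_ifs <;> rfl
      · by_cases h1 : S.tgt a = S.src b
        · by_cases h2 : S.tgt b = S.src c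
          · simp [h1, h2, Zt.mul', S.tgt_mul a b h1, S.src_mul b c h2, S.mul_assoc' a b c h1 h2]
          · simp [h1, h2, Zt.mul', S.tgt_mul a b h1]
        · by_cases h2 : S.tgt b = S.src c
          · simp [h1, h2, Zt.mul', S.src_mul b c h2]
          · simp [h1, h2, Zt.mul']

noncomputable instance : Monoid (Zt S) where
  mul := Zt.mul'
  one := .one
  mul_assoc := Zt.mul'_assoc
  one_mul x := by show Zt.mul' .one x = x; cases x <;> rfl
  mul_one x := by show Zt.mul' x .one = x; cases x <;> rfl

theorem Zt.arr_mul {a b : A} (h : S.tgt a = S.src b) :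
    (Zt.arr a : Zt S) * Zt.arr b = Zt.arr (S.mul a b) := by
  show Zt.mul' _ _ = _
  simp [Zt.mul', h]

theorem Zt.arr_ne_one (a : A) : (Zt.arr a : Zt S) ≠ 1 := by
  intro h
  have : (Zt.arr a : Zt S) = Zt.one := h
  cases this

theorem Zt.mul_eq_arr {x y : Zt S} {a : A} (h : x * y = .arr a) :
    (x = 1 ∧ y = .arr a) ∨ (y = 1 ∧ x = .arr a) ∨
      ∃ b c, x = .arr b ∧ y = .arr c ∧ S.tgt b = S.src c ∧ a = S.mul b c := by
  have h' : Zt.mul' x y = .arr a := h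
  rcases x with _ | _ | b <;> rcases y with _ | _ | c <;> simp only [Zt.mul'] at h'
  · cases h'
  · cases h'
  · cases h'
  · cases h'
  · cases h'
  · exact Or.inl ⟨rfl, h'⟩
  · cases h'
  · exact Or.inr (Or.inl ⟨rfl, h'⟩)
  · split_ifs at h' with hh
    · exact Or.inr (Or.inr ⟨b, c, rfl, rfl, hh, by injection h' with h'; exact h'.symm⟩)

theorem Zt.arr_mul_arr {a b c : A} (h : (Zt.arr a : Zt S) * .arr b = .arr c) :
    S.tgt a = S.src b ∧ c = S.mul a b := by
  rcases Zt.mul_eq_arr h with ⟨h1, _⟩ | ⟨h1, _⟩ | ⟨b', c', h1, h2, h3, h4⟩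
  · exact absurd h1 (Zt.arr_ne_one _)
  · exact absurd h1 (Zt.arr_ne_one _)
  · injection h1 with h1; injection h2 with h2; subst h1; subst h2; exact ⟨h3, h4⟩

theorem Zt.arr_inj {a b : A} (h : (Zt.arr a : Zt S) = .arr b) : a = b := by
  injection h

/-- Right factors of an arrow that are not identities are arrows with the same target. -/
theorem Zt.right_arr {x y : Zt S} {a : A} (h : x * y = .arr a) (hy : y ≠ 1) :
    ∃ c, y = .arr c ∧ S.tgt c = S.tgt a := by
  rcases Zt.mul_eq_arr h with ⟨_, h1⟩ | ⟨h1, _⟩ | ⟨b', c', h1, h2, h3, h4⟩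
  · exact ⟨a, h1, rfl⟩
  · exact absurd h1 hy
  · exact ⟨c', h2, by rw [h4, S.tgt_mul _ _ h3]⟩

theorem Zt.left_arr {x y : Zt S} {a : A} (h : x * y = .arr a) (hx : x ≠ 1) :
    ∃ c, x = .arr c ∧ S.src c = S.src a := by
  rcases Zt.mul_eq_arr h with ⟨h1, _⟩ | ⟨_, h1⟩ | ⟨b', c', h1, h2, h3, h4⟩
  · exact absurd h1 hx
  · exact ⟨a, h1, rfl⟩
  · exact ⟨b', h1, by rw [h4, S.src_mul _ _ h3]⟩

theorem Zt.mul_ne_one {x : Zt S} {a : A} : (Zt.arr a : Zt S) * x ≠ 1 := by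
  intro h
  have h' : Zt.mul' (.arr a) x = .one := h
  rcases x with _ | _ | b <;> simp only [Zt.mul'] at h'
  · cases h'
  · cases h'
  · split_ifs at h'

theorem Zt.mul_ne_one' {x : Zt S} {a : A} : x * (Zt.arr a : Zt S) ≠ 1 := by
  intro h
  have h' : Zt.mul' x (.arr a) = .one := h
  rcases x with _ | _ | b <;> simp only [Zt.mul'] at h'
  · cases h'
  · cases h'
  · split_ifs at h'

end Zt

section Val
variable {O A E : Type} {S : Sgpd O A} (C : ChoiceOfReps S.toPreSgpd E)

/-- Value of a word of edges in `Zt S`. -/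
noncomputable def val (l : List E) : Zt S := (l.map fun e => (Zt.arr (C.lab e) : Zt S)).prod

@[simp] theorem val_nil : val C [] = 1 := rfl
theorem val_append (l m : List E) : val C (l ++ m) = val C l * val C m := by simp [val]
theorem val_cons (e : E) (m : List E) : val C (e :: m) = Zt.arr (C.lab e) * val C m := by
  simp [val]
theorem val_singleton (e : E) : val C [e] = Zt.arr (C.lab e) := by
  simp [val]
theorem val_ne_one {l : List E} (h : l ≠ []) : val C l ≠ 1 := by
  cases l with
  | nil => simp at h
  | cons e l => rw [val_cons]; exact Zt.mul_ne_one

theorem evalPath_snoc {O A E : Type} (S : PreSgpd O A) (lab : E → A) {l : List E} {a : A}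
    (h : evalPath? S lab l = some a) (e : E) :
    evalPath? S lab (l ++ [e]) = some (S.mul a (lab e)) := by
  cases l with
  | nil => simp [evalPath?] at h
  | cons b l =>
    simp only [evalPath?, Option.some.injEq] at h
    simp [evalPath?, h]

theorem val_path {l : List E} (hl : l ≠ []) (hp : IsPathChain C.esrc C.etgt l) :
    ∃ a, val C l = .arr a ∧ evalPath? S.toPreSgpd C.lab l = some a ∧
      pathTgt? C.etgt l = some (S.tgt a) := by
  induction l using List.reverseRecOn with
  | nil => simp at hl
  | append_singleton l e ih =>
    by_cases h0 : l = []
    · subst h0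
      exact ⟨C.lab e, val_singleton C e, rfl, by simp [pathTgt?, C.lab_tgt]⟩
    · have hp' : IsPathChain C.esrc C.etgt l ∧ ∀ x ∈ l.getLast?, C.etgt x = C.esrc e := by
        have := List.isChain_append.1 hp
        exact ⟨this.1, fun x hx => this.2.2 x hx e (by simp)⟩
      obtain ⟨a, h1, h2, h3⟩ := ih h0 hp'.1
      have h4 : S.tgt a = S.src (C.lab e) := by
        rw [C.lab_src]
        have h5 := hp'.2 (l.getLast h0) (by simp [List.getLast?_eq_getLast_of_ne_nil h0])
        rw [← h5]
        simp only [pathTgt?, List.getLast?_eq_getLast_of_ne_nil h0, Option.map_some,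
          Option.some.injEq] at h3
        exact h3.symm
      refine ⟨S.mul a (C.lab e), ?_, evalPath_snoc _ _ h2 e, ?_⟩
      · rw [val_append, h1, val_singleton, Zt.arr_mul h4]
      · simp [pathTgt?, S.tgt_mul a _ h4, C.lab_tgt]

theorem K_val {l : List E} (hl : l ∈ C.K) :
    ∃ a, val C l = .arr a ∧ evalPath? S.toPreSgpd C.lab l = some a ∧
      pathTgt? C.etgt l = some (S.tgt a) :=
  val_path C (C.K_path l hl).1 (C.K_path l hl).2

theorem K_eval_iff {l : List E} (hl : l ∈ C.K) (a : A) :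
    evalPath? S.toPreSgpd C.lab l = some a ↔ val C l = .arr a := by
  obtain ⟨b, h1, h2, _⟩ := K_val C hl
  rw [h1, h2]
  constructor
  · intro h; rw [Option.some.inj h]
  · intro h; rw [Zt.arr_inj h]

theorem K_onto' (a : A) : ∃ l ∈ C.K, val C l = .arr a := by
  obtain ⟨l, hl, h⟩ := C.K_onto a
  exact ⟨l, hl, (K_eval_iff C hl a).1 h⟩

theorem relEdge_eq (e : E) : relEdge C e =
    {p | p.1 ∈ C.K ∧ p.2 ∈ C.K ∧ val C p.1 * val C [e] = val C p.2} := by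
  ext ⟨u, v⟩
  simp only [relEdge, Set.mem_ofPred_eq]
  refine and_congr_right fun hu => and_congr_right fun hv => ?_
  obtain ⟨a, h1, h2, h3⟩ := K_val C hu
  obtain ⟨b, h1', h2', h3'⟩ := K_val C hv
  rw [evalPath_snoc _ _ h2 e, h3, h2', h1, h1', val_singleton, ← C.lab_src]
  constructor
  · rintro ⟨h4, h5⟩
    rw [Zt.arr_mul (Option.some.inj h4), Option.some.inj h5]
  · intro h
    obtain ⟨h4, h5⟩ := Zt.arr_mul_arr h
    rw [h4, h5]; exact ⟨rfl, rfl⟩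

/-- Right multiplication by a fixed arrow is an automatic relation. -/
theorem autoRel_mul (hC : IsAutomaticStructure C) (s : A) :
    AutoRel {p : List E × List E | p.1 ∈ C.K ∧ p.2 ∈ C.K ∧ val C p.1 * .arr s = val C p.2} := by
  have key : ∀ l : List E, l ≠ [] → AutoRel {p : List E × List E |
      p.1 ∈ C.K ∧ p.2 ∈ C.K ∧ val C p.1 * val C l = val C p.2} := by
    intro l
    induction l with
    | nil => intro h; simp at h
    | cons e l ih =>
      intro _
      have h1 := autoRel_of_sync (hC.2.2.1 e)
      rw [relEdge_eq] at h1
      by_cases h0 : l = []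
      · subst h0; exact h1
      · have h2 := AutoRel.comp h1 (ih h0)
        convert h2 using 1
        ext ⟨u, w⟩
        simp only [Set.mem_ofPred_eq]
        rw [val_cons, ← val_singleton, ← mul_assoc]
        constructor
        · rintro ⟨hu, hw, h⟩
          obtain ⟨b, hb, _⟩ := K_val C hw
          rw [hb] at h
          obtain ⟨c, hc, _⟩ := Zt.left_arr h (by rw [val_singleton]; exact Zt.mul_ne_one')
          obtain ⟨v, hv, hvc⟩ := K_onto' C c
          exact ⟨v, ⟨hu, hv, by rw [hc, hvc]⟩, hv, hw, by rw [hvc, ← hc, h, hb]⟩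
        · rintro ⟨v, ⟨hu, hv, h⟩, _, hw, h'⟩
          exact ⟨hu, hw, by rw [h, h']⟩
  obtain ⟨l, hl, h⟩ := K_onto' C s
  rw [← h]
  exact key l (C.K_path l hl).1

theorem autoRel_eq (hC : IsAutomaticStructure C) (v : O) :
    AutoRel {p : List E × List E | p.1 ∈ C.K ∧ p.2 ∈ C.K ∧ pathTgt? C.etgt p.1 = some v ∧
      val C p.1 = val C p.2} := by
  have := autoRel_of_sync (hC.2.2.2 v)
  convert this using 1
  ext ⟨u, w⟩
  simp only [relVertex, Set.mem_ofPred_eq]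
  refine and_congr_right fun hu => and_congr_right fun hw => and_congr_right fun _ => ?_
  obtain ⟨b, hb, hb', _⟩ := K_val C hw
  rw [hb, hb', K_eval_iff C hu]

end Val

/-! ### Consequences of finite generation -/
section FG
variable {O A I Λ : Type} {S : Sgpd O A} {R : Rees.Data0 S I Λ}

/-- Non-zero elements of the Rees matrix semigroup. -/
def mk (t : Rees.Triples S R.F R.G) : Rees.Carrier0 S R := some t
/-- The zero of the Rees matrix semigroup. -/
def zr : Rees.Carrier0 S R := none

theorem match_aux {β : Type} (g : Λ → I → Option A) (l : Λ) (i : I)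
    (f : (p : A) → g l i = some p → β) (z : β) (p : A)
    (h : g l i = some p) : (match hp : g l i with | some p => f p hp | none => z) = f p h := by
  split
  · rename_i q hq
    have : q = p := Option.some.inj (hq.symm.trans h)
    subst this; rfl
  · rename_i hq
    exact absurd (hq.symm.trans h) (by simp)

theorem match_aux' {β : Type} (g : Λ → I → Option A) (l : Λ) (i : I)
    (f : (p : A) → g l i = some p → β) (z : β)
    (h : g l i = none) : (match hp : g l i with | some p => f p hp | none => z) = z := by
  split
  · rename_i q hq
    exact absurd (hq.symm.trans h) (by simp)
  · rfl

theorem mul0_some {t t' : Rees.Triples S R.F R.G} {p : A} (h : R.P t.1.2.2 t'.1.1 = some p) :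
    ∃ u : Rees.Triples S R.F R.G, Rees.mul0 S R (mk t) (mk t') = mk u ∧
      u.1 = (t.1.1, S.mul (S.mul t.1.2.1 p) t'.1.2.1, t'.1.2.2) := by
  rcases t with ⟨⟨i, x, l⟩, ht⟩
  rcases t' with ⟨⟨j, y, m⟩, ht'⟩
  exact ⟨_, match_aux R.P l j _ none p h, rfl⟩

theorem mul0_none {t t' : Rees.Triples S R.F R.G} (h : R.P t.1.2.2 t'.1.1 = none) :
    Rees.mul0 S R (mk t) (mk t') = zr := by
  rcases t with ⟨⟨i, x, l⟩, ht⟩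
  rcases t' with ⟨⟨j, y, m⟩, ht'⟩
  exact match_aux' R.P l j _ none h

theorem carrier_cases (x : Rees.Carrier0 S R) : x = zr ∨ ∃ t, x = mk t := by
  rcases x with _ | t
  · exact Or.inl rfl
  · exact Or.inr ⟨t, rfl⟩

theorem mk_ne_zr (t : Rees.Triples S R.F R.G) : (mk t : Rees.Carrier0 S R) ≠ zr := by
  intro h
  have : (some t : Option (Rees.Triples S R.F R.G)) = none := h
  cases this

theorem mk_inj {t u : Rees.Triples S R.F R.G} (h : (mk t : Rees.Carrier0 S R) = mk u) : t = u :=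
  Option.some.inj h

theorem zr_mul (x : Rees.Carrier0 S R) : Rees.mul0 S R zr x = zr := by
  rcases x with _ | ⟨⟨i, x, l⟩, ht⟩ <;> rfl

theorem mul_zr (x : Rees.Carrier0 S R) : Rees.mul0 S R x zr = zr := by
  rcases x with _ | ⟨⟨i, x, l⟩, ht⟩ <;> rfl

theorem mul0_eq_some {x y : Rees.Carrier0 S R} {u : Rees.Triples S R.F R.G}
    (h : Rees.mul0 S R x y = mk u) : ∃ t t' p, x = mk t ∧ y = mk t' ∧
      R.P t.1.2.2 t'.1.1 = some p ∧
      u.1 = (t.1.1, S.mul (S.mul t.1.2.1 p) t'.1.2.1, t'.1.2.2) := by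
  rcases carrier_cases x with rfl | ⟨t, rfl⟩
  · rw [zr_mul] at h; exact absurd h.symm (mk_ne_zr _)
  rcases carrier_cases y with rfl | ⟨t', rfl⟩
  · rw [mul_zr] at h; exact absurd h.symm (mk_ne_zr _)
  rcases hp : R.P t.1.2.2 t'.1.1 with _ | p
  · rw [mul0_none hp] at h; exact absurd h.symm (mk_ne_zr _)
  · obtain ⟨u', h1, h2⟩ := mul0_some hp
    rw [h1] at h
    have := mk_inj h
    subst this
    exact ⟨t, t', p, rfl, rfl, hp, h2⟩

theorem fg_aux {l : List (Rees.Carrier0 S R)} {u : Rees.Triples S R.F R.G}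
    (h : evalPath? (Rees.pre0 S R) id l = some (mk u)) :
    (∃ t : Rees.Triples S R.F R.G, mk t ∈ l ∧ t.1.1 = u.1.1) ∧
    (∃ t : Rees.Triples S R.F R.G, mk t ∈ l ∧ t.1.2.2 = u.1.2.2) ∧
    ((∃ t : Rees.Triples S R.F R.G, mk t ∈ l ∧ t.1.2.1 = u.1.2.1) ∨
      u.1.2.1 ∈ Rees.SPS0 S R) := by
  induction l using List.reverseRecOn generalizing u with
  | nil => simp [evalPath?] at h
  | append_singleton l e ih =>
    rcases hl : evalPath? (Rees.pre0 S R) id l with _ | m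
    · have h0 : l = [] := by
        cases l with
        | nil => rfl
        | cons => simp [evalPath?] at hl
      subst h0
      have he : e = mk u := by simpa [evalPath?] using h
      subst he
      exact ⟨⟨u, by simp, rfl⟩, ⟨u, by simp, rfl⟩, Or.inl ⟨u, by simp, rfl⟩⟩
    · rw [evalPath_snoc _ _ hl] at h
      obtain ⟨t, t', p, rfl, h2, hp, hu⟩ := mul0_eq_some (Option.some.inj h)
      obtain ⟨⟨t1, h3, h4⟩, -, -⟩ := ih hl
      have h2 : e = mk t' := h2
      subst h2
      refine ⟨⟨t1, by simp [h3], by rw [h4, hu]⟩, ⟨t', by simp, by rw [hu]⟩, Or.inr ?_⟩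
      refine ⟨t.1.2.1, p, t'.1.2.1, _, _, hp, ?_, ?_, by rw [hu]⟩
      · rw [R.P_src _ _ _ hp]; exact t.2.2
      · rw [R.P_tgt _ _ _ hp]; exact t'.2.1

theorem fg_finite (h : IsFG (Rees.pre0 S R)) :
    Finite I ∧ Finite Λ ∧ (Rees.SPS0 S R)ᶜ.Finite := by
  obtain ⟨T, hT, hgen⟩ := h
  have hT' : {t : Rees.Triples S R.F R.G | (mk t : Rees.Carrier0 S R) ∈ T}.Finite :=
    Set.Finite.preimage (fun _ _ _ _ h => mk_inj h) hT
  have hgen' : ∀ u : Rees.Triples S R.F R.G, ∃ l : List (Rees.Carrier0 S R),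
      (∀ x ∈ l, x ∈ T) ∧ evalPath? (Rees.pre0 S R) id l = some (mk u) := by
    intro u
    obtain ⟨l, _, h1, _, h2⟩ := hgen (mk u)
    exact ⟨l, h1, h2⟩
  refine ⟨?_, ?_, ?_⟩
  · apply Set.finite_univ_iff.1
    refine (hT'.image (fun t => t.1.1)).subset ?_
    intro i _
    obtain ⟨a, ha⟩ := R.F_into i
    obtain ⟨m, hm⟩ := R.G_onto a
    obtain ⟨l, h1, h2⟩ := hgen' ⟨(i, a, m), ha.symm, hm.symm⟩
    obtain ⟨⟨t, ht, hti⟩, -, -⟩ := fg_aux h2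
    exact ⟨t, h1 _ ht, hti⟩
  · apply Set.finite_univ_iff.1
    refine (hT'.image (fun t => t.1.2.2)).subset ?_
    intro m _
    obtain ⟨a, ha⟩ := R.G_into m
    obtain ⟨i, hi⟩ := R.F_onto a
    obtain ⟨l, h1, h2⟩ := hgen' ⟨(i, a, m), hi, ha⟩
    obtain ⟨-, ⟨t, ht, hti⟩, -⟩ := fg_aux h2
    exact ⟨t, h1 _ ht, hti⟩
  · refine (hT'.image (fun t => t.1.2.1)).subset ?_
    intro a ha
    obtain ⟨i, hi⟩ := R.F_onto a
    obtain ⟨m, hm⟩ := R.G_onto a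
    obtain ⟨l, h1, h2⟩ := hgen' ⟨(i, a, m), hi, hm.symm⟩
    obtain ⟨-, -, ⟨t, ht, hti⟩ | h3⟩ := fg_aux h2
    · exact ⟨t, h1 _ ht, hti⟩
    · exact absurd h3 ha

/-- `SPS0` absorbs right multiplication. -/
theorem SPS0_mul {a b : A} (ha : a ∈ Rees.SPS0 S R) (h : S.tgt a = S.src b) :
    S.mul a b ∈ Rees.SPS0 S R := by
  obtain ⟨s, p, t, m, i, hp, h1, h2, rfl⟩ := ha
  have h3 : S.tgt (S.mul s p) = S.src t := by rw [S.tgt_mul _ _ h1, h2]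
  rw [S.tgt_mul _ _ h3] at h
  exact ⟨s, p, S.mul t b, m, i, hp, h1, by rw [S.src_mul _ _ h, h2], S.mul_assoc' _ _ _ h3 h⟩

end FG

/-! ### Representatives whose long factors lie in `SPS0` -/
section Short
variable {O A I Λ E : Type} {S : Sgpd O A} (R : Rees.Data0 S I Λ)
  (C : ChoiceOfReps S.toPreSgpd E)

/-- All factors of length `B` have value in `SPS0`. -/
def Good (B : ℕ) (w : List E) : Prop :=
  ∀ u β v, w = u ++ β ++ v → β.length = B → ∃ a ∈ Rees.SPS0 S R, val C β = .arr a

theorem exists_good (hK : IsRegularSet C.K) (hfin : (Rees.SPS0 S R)ᶜ.Finite) :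
    ∃ B, 0 < B ∧ ∀ a : A, ∃ w ∈ C.K, val C w = .arr a ∧ Good R C B w := by
  classical
  obtain ⟨σ, _, F, step, q0, hF, hFK⟩ := reg_family hK
  have : Finite ((Rees.SPS0 S R)ᶜ : Set A) := hfin
  have := Fintype.ofFinite (σ × ((Rees.SPS0 S R)ᶜ : Set A))
  refine ⟨Fintype.card (σ × ((Rees.SPS0 S R)ᶜ : Set A)) + 1, by omega, ?_⟩
  set N := Fintype.card (σ × ((Rees.SPS0 S R)ᶜ : Set A)) with hN
  intro a
  -- a shortest representative
  have hex : ∃ n, ∃ w ∈ C.K, val C w = .arr a ∧ w.length = n := by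
    obtain ⟨w, hw, h⟩ := K_onto' C a
    exact ⟨_, w, hw, h, rfl⟩
  obtain ⟨w, hw, hwa, hlen⟩ := Nat.find_spec hex
  refine ⟨w, hw, hwa, ?_⟩
  rintro u β v rfl hβ
  by_contra hcon
  have hpre : ∀ k : Fin (N + 1), ∃ b : ((Rees.SPS0 S R)ᶜ : Set A),
      val C (β.take (k + 1)) = .arr b.1 := by
    intro k
    have hβ1 : β ≠ [] := by intro h; simp [h] at hβ
    have h1 : β.take (k + 1) ≠ [] := by simp [hβ1]
    have hx : ∃ y, val C β = .arr y := by
      rw [val_append] at hwa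
      by_cases hu : u ++ β = []
      · simp [hβ1] at hu
      · obtain ⟨c, hc, _⟩ := Zt.left_arr hwa (val_ne_one C hu)
        rw [val_append] at hc
        obtain ⟨d, hd, _⟩ := Zt.right_arr hc (val_ne_one C hβ1)
        exact ⟨d, hd⟩
    obtain ⟨y, hy⟩ := hx
    have hy' := hy
    rw [← List.take_append_drop (k + 1) β, val_append] at hy'
    obtain ⟨b, hb, _⟩ := Zt.left_arr hy' (val_ne_one C h1)
    refine ⟨⟨b, fun hbS => hcon ⟨y, ?_, hy⟩⟩, hb⟩
    rw [hb] at hy'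
    rcases Zt.mul_eq_arr hy' with ⟨h2, _⟩ | ⟨_, h2⟩ | ⟨b', c', h2, _, h3, h4⟩
    · exact absurd h2 (Zt.arr_ne_one _)
    · rw [← Zt.arr_inj h2]; exact hbS
    · rw [h4, ← Zt.arr_inj h2]
      rw [← Zt.arr_inj h2] at h3
      exact SPS0_mul hbS h3
  choose f hf using hpre
  obtain ⟨k, k', hne, heq⟩ := Fintype.exists_ne_map_eq_of_card_lt
    (fun k : Fin (N + 1) => ((u ++ β.take (k + 1)).foldl step q0, f k)) (by simp [hN])
  wlog hlt : k < k' generalizing k k'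
  · exact this k' k hne.symm heq.symm (lt_of_le_of_ne (not_lt.1 hlt) hne.symm)
  simp only [Prod.mk.injEq] at heq
  have hlt' : (k : ℕ) < k' := hlt
  have hk' : (k' : ℕ) < N + 1 := k'.2
  have hdec : u ++ β ++ v = (u ++ β.take (k' + 1)) ++ (β.drop (k' + 1) ++ v) := by
    rw [List.append_assoc u (List.take _ _), ← List.append_assoc (List.take _ _),
      List.take_append_drop, List.append_assoc]
  let w' := (u ++ β.take (k + 1)) ++ (β.drop (k' + 1) ++ v)
  have hw'K : w' ∈ C.K := by
    rw [hdec] at hw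
    rw [← hFK] at hw ⊢
    rw [family_append hF] at hw ⊢
    rw [heq.1]; exact hw
  have hw'a : val C w' = .arr a := by
    rw [hdec] at hwa
    rw [← hwa]
    simp only [w', val_append, hf, heq.2]
  have := Nat.find_min' hex ⟨w', hw'K, hw'a, rfl⟩
  rw [← hlen] at this
  simp only [w', List.length_append, List.length_take, List.length_drop, hβ] at this
  omega

end Short
end AutoRees

namespace AutoRees
/-! ### The block encoding -/
section Enc
variable {O A I Λ E : Type} {S : Sgpd O A} (R : Rees.Data0 S I Λ)
  (C : ChoiceOfReps S.toPreSgpd E) (B : ℕ)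

/-- Blocks: words of length `B` with value in `SPS0`. -/
def Blk : Type := {l : List E // l.length = B ∧ ∃ a ∈ Rees.SPS0 S R, val C l = .arr a}

/-- Remainders: words of length less than `B`. -/
def Rmd (E : Type) (B : ℕ) : Type := {l : List E // l.length < B}

theorem blk_fac (β : Blk R C B) : ∃ f : A × A × A × Λ × I,
    R.P f.2.2.2.1 f.2.2.2.2 = some f.2.1 ∧ S.tgt f.1 = S.src f.2.1 ∧ S.tgt f.2.1 = S.src f.2.2.1 ∧
    val C β.1 = .arr f.1 * .arr f.2.1 * .arr f.2.2.1 := by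
  obtain ⟨a, ⟨s, p, t, m, i, hp, h1, h2, rfl⟩, ha⟩ := β.2.2
  refine ⟨(s, p, t, m, i), hp, h1, h2, ?_⟩
  rw [ha, Zt.arr_mul h1, Zt.arr_mul]
  rw [S.tgt_mul _ _ h1, h2]

/-- The left, middle and right factors of a block, with the row and column used. -/
noncomputable def fac (β : Blk R C B) : A × A × A × Λ × I := (blk_fac R C B β).choose

theorem fac_spec (β : Blk R C B) :
    R.P (fac R C B β).2.2.2.1 (fac R C B β).2.2.2.2 = some (fac R C B β).2.1 ∧
    S.tgt (fac R C B β).1 = S.src (fac R C B β).2.1 ∧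
    S.tgt (fac R C B β).2.1 = S.src (fac R C B β).2.2.1 ∧
    val C β.1 = .arr (fac R C B β).1 * .arr (fac R C B β).2.1 * .arr (fac R C B β).2.2.1 :=
  (blk_fac R C B β).choose_spec

/-- Letters of the new alphabet. -/
abbrev Ltr : Type := Option ((I ⊕ Blk R C B) × (Blk R C B ⊕ Rmd E B × Λ))

/-- The column index and the left factor carried by the first half of a letter. -/
noncomputable def lft : I ⊕ Blk R C B → I × Zt S
  | .inl i => (i, 1)
  | .inr β => ((fac R C B β).2.2.2.2, .arr (fac R C B β).2.2.1)

/-- The right factor and the row index carried by the second half of a letter. -/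
noncomputable def rgt : Blk R C B ⊕ Rmd E B × Λ → Zt S × Λ
  | .inl β => (.arr (fac R C B β).1, (fac R C B β).2.2.2.1)
  | .inr (r, m) => (val C r.1, m)

/-- `t` is the element represented by a letter. -/
def Rep (p : I ⊕ Blk R C B) (c : Blk R C B ⊕ Rmd E B × Λ) (t : Rees.Triples S R.F R.G) : Prop :=
  t.1.1 = (lft R C B p).1 ∧ .arr t.1.2.1 = (lft R C B p).2 * (rgt R C B c).1 ∧
    t.1.2.2 = (rgt R C B c).2

open Classical in
/-- The labelling of the new alphabet. -/
noncomputable def labL : Ltr R C B → Rees.Carrier0 S R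
  | none => zr
  | some (p, c) => if h : ∃ t, Rep R C B p c t then mk h.choose else zr

theorem labL_ne {p c} (h : labL R C B (some (p, c)) ≠ zr) :
    ∃ t, labL R C B (some (p, c)) = mk t ∧ Rep R C B p c t := by
  simp only [labL] at h ⊢
  by_cases h' : ∃ t, Rep R C B p c t
  · rw [dif_pos h']
    exact ⟨_, rfl, h'.choose_spec⟩
  · rw [dif_neg h'] at h
    exact absurd rfl h

theorem labL_ne_of {p c} {t} (h : Rep R C B p c t) : labL R C B (some (p, c)) ≠ zr := by
  simp only [labL]
  rw [dif_pos ⟨t, h⟩]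
  exact mk_ne_zr _

/-- The word of edges encoded by a letter. -/
def cur : Ltr R C B → List E
  | none => []
  | some (_, .inl β) => β.1
  | some (_, .inr (r, _)) => r.1

theorem cur_length (e : Ltr R C B) : (cur R C B e).length ≤ B := by
  rcases e with _ | ⟨p, β | ⟨r, m⟩⟩
  · simp [cur]
  · exact β.2.1.le
  · exact r.2.le

/-- Decoding. -/
def dec (z : List (Ltr R C B)) : List E := z.flatMap (cur R C B)

/-- Valid encodings. -/
def Vld (lam : Λ) : (I ⊕ Blk R C B) → List (Ltr R C B) → Prop
  | _, [] => False
  | p, e :: z => labL R C B e ≠ zr ∧ ((∃ β, e = some (p, .inl β) ∧ Vld lam (.inr β) z) ∨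
      ∃ r, e = some (p, .inr (r, lam)) ∧ z = [])

theorem Vld.ne_nil {lam : Λ} {p} {z} (h : Vld R C B lam p z) : z ≠ [] := by
  rintro rfl; exact h

theorem blk_finite [Finite E] : Finite (Blk R C B) :=
  ((List.finite_length_eq E B).subset fun _ h => h.1 :
    {l : List E | l.length = B ∧ ∃ a ∈ Rees.SPS0 S R, val C l = .arr a}.Finite)

theorem rmd_finite [Finite E] : Finite (Rmd E B) := List.finite_length_lt E B

theorem reg_vld [Finite E] [Finite I] (lam : Λ) (p : I ⊕ Blk R C B) :
    IsRegularSet {z | Vld R C B lam p z} := by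
  have := blk_finite R C B
  let F : Option (I ⊕ Blk R C B) → Set (List (Ltr R C B)) := fun q => match q with
    | some p => {z | Vld R C B lam p z}
    | none => {[]}
  refine reg_of_nfamily F (fun q e => match q with
    | some p => {q' | labL R C B e ≠ zr ∧ ((∃ β, e = some (p, .inl β) ∧ q' = some (.inr β)) ∨
      ∃ r, e = some (p, .inr (r, lam)) ∧ q' = none)}
    | none => ∅) ?_ (some p)
  intro q e w
  rcases q with _ | p
  · simp [F]
  · simp only [F, Set.mem_ofPred_eq, Vld]
    constructor
    · rintro ⟨h0, ⟨β, h1, h2⟩ | ⟨r, h1, h2⟩⟩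
      · exact ⟨_, ⟨h0, Or.inl ⟨β, h1, rfl⟩⟩, h2⟩
      · exact ⟨_, ⟨h0, Or.inr ⟨r, h1, rfl⟩⟩, h2⟩
    · rintro ⟨_, ⟨h0, ⟨β, h1, rfl⟩ | ⟨r, h1, rfl⟩⟩, h2⟩
      · exact ⟨h0, Or.inl ⟨β, h1, h2⟩⟩
      · exact ⟨h0, Or.inr ⟨r, h1, h2⟩⟩

theorem dec_cons (e) (z) : dec R C B (e :: z) = cur R C B e ++ dec R C B z := rfl

theorem prod_aux (lam : Λ) : ∀ (z : List (Ltr R C B)) (β : Blk R C B)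
    (t : Rees.Triples S R.F R.G), Vld R C B lam (.inr β) z → t.1.2.2 = (fac R C B β).2.2.2.1 →
    ∃ t', (z.map (labL R C B)).foldl (Rees.mul0 S R) (mk t) = mk t' ∧ t'.1.1 = t.1.1 ∧
      t'.1.2.2 = lam ∧ (.arr t'.1.2.1 : Zt S) = .arr t.1.2.1 *
        (.arr (fac R C B β).2.1 * .arr (fac R C B β).2.2.1) * val C (dec R C B z) := by
  intro z
  induction z with
  | nil => intro β t h; exact absurd h id
  | cons e z ih =>
    rintro β t ⟨h0, h⟩ ht
    have hstep : ∀ c, e = some (.inr β, c) → ∃ t', Rees.mul0 S R (mk t) (labL R C B e) = mk t' ∧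
        t'.1.1 = t.1.1 ∧ t'.1.2.2 = (rgt R C B c).2 ∧ (.arr t'.1.2.1 : Zt S) = .arr t.1.2.1 *
        (.arr (fac R C B β).2.1 * .arr (fac R C B β).2.2.1) * (rgt R C B c).1 := by
      rintro c rfl
      obtain ⟨t1, h1, h2, h3, h4⟩ := labL_ne R C B h0
      obtain ⟨f1, f2, f3, f4⟩ := fac_spec R C B β
      have hP : R.P t.1.2.2 t1.1.1 = some (fac R C B β).2.1 := by
        rw [ht, h2]; exact f1
      obtain ⟨u, hu, hu'⟩ := mul0_some hP
      have e1 : S.tgt t.1.2.1 = S.src (fac R C B β).2.1 := by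
        rw [R.P_src _ _ _ hP]; exact t.2.2
      have e2 : S.tgt (S.mul t.1.2.1 (fac R C B β).2.1) = S.src t1.1.2.1 := by
        rw [S.tgt_mul _ _ e1, R.P_tgt _ _ _ hP]; exact t1.2.1
      refine ⟨u, by rw [h1, hu], by rw [hu'], by rw [hu', h4], ?_⟩
      rw [hu', ← Zt.arr_mul e2, ← Zt.arr_mul e1, h3]
      simp only [lft, mul_assoc]
    rw [List.map_cons, List.foldl_cons]
    rcases h with ⟨β', rfl, hz⟩ | ⟨r, rfl, rfl⟩
    · obtain ⟨t', h1, h2, h3, h4⟩ := hstep _ rfl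
      obtain ⟨t'', k1, k2, k3, k4⟩ := ih β' t' hz h3
      refine ⟨t'', by rw [h1, k1], by rw [k2, h2], k3, ?_⟩
      rw [k4, h4, dec_cons, val_append]
      have := (fac_spec R C B β').2.2.2
      simp only [cur, this, rgt, mul_assoc]
    · obtain ⟨t', h1, h2, h3, h4⟩ := hstep _ rfl
      refine ⟨t', by rw [h1]; rfl, h2, h3, ?_⟩
      rw [h4, dec_cons]
      simp [cur, rgt, dec]

theorem prod_main (lam : Λ) (i : I) (z : List (Ltr R C B)) (h : Vld R C B lam (.inl i) z) :
    ∃ t, evalPath? (Rees.pre0 S R) (labL R C B) z = some (mk t) ∧ t.1.1 = i ∧ t.1.2.2 = lam ∧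
      (.arr t.1.2.1 : Zt S) = val C (dec R C B z) := by
  cases z with
  | nil => exact absurd h id
  | cons e z =>
    obtain ⟨h0, ⟨β, rfl, hz⟩ | ⟨r, rfl, rfl⟩⟩ := h
    · obtain ⟨t1, h1, h2, h3, h4⟩ := labL_ne R C B h0
      obtain ⟨t', k1, k2, k3, k4⟩ := prod_aux R C B lam z β t1 hz h4
      refine ⟨t', ?_, by rw [k2, h2]; rfl, k3, ?_⟩
      · simp only [evalPath?, h1]
        exact congrArg some k1
      · rw [k4, dec_cons, val_append, h3]
        have := (fac_spec R C B β).2.2.2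
        simp only [cur, this, rgt, lft, one_mul, mul_assoc]
    · obtain ⟨t1, h1, h2, h3, h4⟩ := labL_ne R C B h0
      refine ⟨t1, ?_, h2, h4, ?_⟩
      · simp only [evalPath?, h1]; rfl
      · rw [h3, dec_cons]
        simp [cur, rgt, lft, dec]

/-- Every good word has a valid encoding. -/
theorem exists_enc (hB : 0 < B) (lam : Λ) : ∀ (n : ℕ) (w : List E) (p : I ⊕ Blk R C B) (a : A),
    w.length ≤ n → Good R C B w → (lft R C B p).2 * val C w = .arr a →
    R.F (lft R C B p).1 = S.src a → S.tgt a = R.G lam →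
    ∃ z, Vld R C B lam p z ∧ dec R C B z = w := by
  intro n
  induction n with
  | zero =>
    intro w p a hn hg ha h1 h2
    have : w = [] := List.length_eq_zero_iff.1 (by omega)
    subst this
    refine ⟨[some (p, .inr (⟨[], hB⟩, lam))], ⟨?_, Or.inr ⟨_, rfl, rfl⟩⟩, rfl⟩
    exact labL_ne_of R C B (t := ⟨((lft R C B p).1, a, lam), h1, h2⟩) ⟨rfl, ha.symm, rfl⟩
  | succ n ih =>
    intro w p a hn hg ha h1 h2
    by_cases hw : w.length < B
    · refine ⟨[some (p, .inr (⟨w, hw⟩, lam))], ⟨?_, Or.inr ⟨_, rfl, rfl⟩⟩, by simp [dec, cur]⟩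
      exact labL_ne_of R C B (t := ⟨((lft R C B p).1, a, lam), h1, h2⟩) ⟨rfl, ha.symm, rfl⟩
    · have hlen : (w.take B).length = B := by simp; omega
      let β : Blk R C B := ⟨w.take B, hlen, hg [] (w.take B) (w.drop B) (by simp) hlen⟩
      obtain ⟨f1, f2, f3, f4⟩ := fac_spec R C B β
      have hdec : w = β.1 ++ w.drop B := (List.take_append_drop B w).symm
      have ha' := ha
      rw [hdec, val_append, f4] at ha'
      have e1 : (lft R C B p).2 * .arr (fac R C B β).1 * (.arr (fac R C B β).2.1 *
        (.arr (fac R C B β).2.2.1 * val C (w.drop B))) = .arr a := by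
        simpa only [mul_assoc] using ha'
      obtain ⟨x, hx, hxs⟩ := Zt.left_arr e1 Zt.mul_ne_one'
      obtain ⟨x', hx', hxt⟩ := Zt.right_arr hx (Zt.arr_ne_one _)
      have hxt' : S.tgt x = S.tgt (fac R C B β).1 := by rw [← hxt, Zt.arr_inj hx']
      have e2 : (lft R C B p).2 * .arr (fac R C B β).1 * .arr (fac R C B β).2.1 *
        (.arr (fac R C B β).2.2.1 * val C (w.drop B)) = .arr a := by
        simpa only [mul_assoc] using ha'
      obtain ⟨y, hy, hyt⟩ := Zt.right_arr e2 Zt.mul_ne_one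
      obtain ⟨y', hy', hys⟩ := Zt.left_arr hy (Zt.arr_ne_one _)
      have hys' : S.src y = S.src (fac R C B β).2.2.1 := by rw [← hys, Zt.arr_inj hy']
      obtain ⟨z, hz, hzw⟩ := ih (w.drop B) (.inr β) y (by simp; omega) (by
          intro u γ v huv hγ
          refine hg (w.take B ++ u) γ v ?_ hγ
          rw [List.append_assoc, List.append_assoc, ← List.append_assoc u, ← huv,
            List.take_append_drop]) hy (by
            show R.F (fac R C B β).2.2.2.2 = _
            rw [hys', ← f3, R.P_tgt _ _ _ f1]) (by rw [hyt, h2])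
      refine ⟨some (p, .inl β) :: z, ⟨?_, Or.inl ⟨β, rfl, hz⟩⟩, ?_⟩
      · refine labL_ne_of R C B (t := ⟨((lft R C B p).1, x, (fac R C B β).2.2.2.1), ?_, ?_⟩)
          ⟨rfl, hx.symm, rfl⟩
        · show R.F (lft R C B p).1 = S.src x
          rw [hxs, h1]
        · show S.tgt x = R.G (fac R C B β).2.2.2.1
          rw [hxt', f2, R.P_src _ _ _ f1]
      · rw [dec_cons, hzw]
        exact hdec.symm

/-- The padded expansion of a letter. -/
def expd : Option (Ltr R C B) → List (Option E)
  | none => List.replicate B none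
  | some e => (cur R C B e).map some ++ List.replicate (B - (cur R C B e).length) none

theorem expd_length (e) : (expd R C B e).length = B := by
  rcases e with _ | e
  · simp [expd]
  · have := cur_length R C B e
    simp [expd]; omega

theorem pads_dec (lam : Λ) (z) : ∀ p, Vld R C B lam p z →
    Pads (dec R C B z) ((z.map some).flatMap (expd R C B)) := by
  induction z with
  | nil => intro p h; exact absurd h id
  | cons e z ih =>
    rintro p ⟨_, ⟨β, rfl, hz⟩ | ⟨r, rfl, rfl⟩⟩
    · obtain ⟨k, hk⟩ := ih _ hz
      refine ⟨k, ?_⟩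
      rw [dec_cons, List.map_cons, List.flatMap_cons, hk]
      have : B - β.1.length = 0 := by rw [β.2.1]; omega
      simp [expd, cur, this]
    · refine ⟨B - r.1.length, ?_⟩
      simp [dec, expd, cur]

theorem pads_expd {lam : Λ} {z} {p} (h : Vld R C B lam p z) {x} (hx : Pads z x) :
    Pads (dec R C B z) (x.flatMap (expd R C B)) := by
  obtain ⟨k, rfl⟩ := hx
  rw [List.flatMap_append]
  have : (List.replicate k (none : Option (Ltr R C B))).flatMap (expd R C B) =
      List.replicate (k * B) none := by
    induction k with
    | zero => simp
    | succ k ih =>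
      rw [List.replicate_succ, List.flatMap_cons, ih, Nat.succ_mul, Nat.add_comm,
        List.replicate_add]
      rfl
  rw [this, Pads.append]
  exact pads_dec R C B lam z p h

theorem flatMap_fst (c : List (Option (Ltr R C B) × Option (Ltr R C B))) :
    (c.flatMap fun q => (expd R C B q.1).zip (expd R C B q.2)).map Prod.fst =
      (c.map Prod.fst).flatMap (expd R C B) := by
  induction c with
  | nil => rfl
  | cons q c ih =>
    rw [List.flatMap_cons, List.map_append, ih, List.map_cons, List.flatMap_cons,
      List.map_fst_zip]
    rw [expd_length, expd_length]

theorem flatMap_snd (c : List (Option (Ltr R C B) × Option (Ltr R C B))) :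
    (c.flatMap fun q => (expd R C B q.1).zip (expd R C B q.2)).map Prod.snd =
      (c.map Prod.snd).flatMap (expd R C B) := by
  induction c with
  | nil => rfl
  | cons q c ih =>
    rw [List.flatMap_cons, List.map_append, ih, List.map_cons, List.flatMap_cons,
      List.map_snd_zip]
    rw [expd_length, expd_length]

/-- The encoding of an automatic relation is automatic. -/
theorem autoRel_enc [Finite E] [Finite I] {T : Set (List E × List E)} (hT : AutoRel T)
    (i : I) (lam mu : Λ) :
    AutoRel {q : List (Ltr R C B) × List (Ltr R C B) | Vld R C B lam (.inl i) q.1 ∧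
      Vld R C B mu (.inl i) q.2 ∧ (dec R C B q.1, dec R C B q.2) ∈ T} := by
  have h1 := AutoRel.prod (reg_vld R C B lam (.inl i)) (reg_vld R C B mu (.inl i))
  have h2 := reg_flatMap (fun q : Option (Ltr R C B) × Option (Ltr R C B) =>
    (expd R C B q.1).zip (expd R C B q.2)) hT
  have := reg_inter h1 h2
  unfold AutoRel
  convert this using 1
  ext c
  simp only [relLang, Set.mem_ofPred_eq, Set.mem_inter_iff, Set.mem_prod, flatMap_fst,
    flatMap_snd]
  constructor
  · rintro ⟨q, ⟨v1, v2, hq⟩, p1, p2⟩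
    exact ⟨⟨q, ⟨v1, v2⟩, p1, p2⟩, _, hq, pads_expd R C B v1 p1, pads_expd R C B v2 p2⟩
  · rintro ⟨⟨q, ⟨v1, v2⟩, p1, p2⟩, ⟨u, v⟩, hq, p3, p4⟩
    refine ⟨q, ⟨v1, v2, ?_⟩, p1, p2⟩
    rw [(pads_expd R C B v1 p1).unique p3, (pads_expd R C B v2 p2).unique p4]
    exact hq

/-- The language of representatives for the Rees matrix semigroup. -/
def KM : Set (List (Ltr R C B)) :=
  {[none]} ∪ ⋃ q : I × Λ, {z | Vld R C B q.2 (.inl q.1) z} ∩ {z | dec R C B z ∈ C.K}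

theorem reg_part [Finite E] [Finite I] (hK : IsRegularSet C.K) (q : I × Λ) :
    IsRegularSet ({z | Vld R C B q.2 (.inl q.1) z} ∩ {z | dec R C B z ∈ C.K}) :=
  reg_inter (reg_vld R C B q.2 (.inl q.1)) (reg_flatMap (cur R C B) hK)

theorem reg_KM [Finite E] [Finite I] [Finite Λ] (hK : IsRegularSet C.K) :
    IsRegularSet (KM R C B) :=
  reg_union (reg_singleton _) (reg_iUnion fun q => reg_part R C B hK q)

/-- The choice of representatives for the Rees matrix semigroup. -/
noncomputable def CM (hB : 0 < B)
    (hgood : ∀ a : A, ∃ w ∈ C.K, val C w = .arr a ∧ Good R C B w) :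
    ChoiceOfReps (Rees.pre0 S R) (Ltr R C B) where
  esrc _ := ()
  etgt _ := ()
  lab := labL R C B
  lab_src _ := rfl
  lab_tgt _ := rfl
  K := KM R C B
  K_path := by
    intro l hl
    refine ⟨?_, ?_⟩
    · rcases hl with hl | hl
      · rw [Set.mem_singleton_iff.1 hl]; simp
      · obtain ⟨q, hq, _⟩ := Set.mem_iUnion.1 hl
        exact Vld.ne_nil R C B hq
    · clear hl
      unfold IsPathChain
      induction l with
      | nil => exact List.isChain_nil
      | cons a l ih =>
        cases l with
        | nil => exact List.isChain_singleton _
        | cons b l => exact List.isChain_cons_cons.2 ⟨rfl, ih⟩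
  K_onto := by
    intro x
    rcases carrier_cases x with rfl | ⟨t, rfl⟩
    · exact ⟨[none], Or.inl rfl, rfl⟩
    · obtain ⟨w, hw, hwa, hg⟩ := hgood t.1.2.1
      obtain ⟨z, hz, hzw⟩ := exists_enc R C B hB t.1.2.2 w.length w (.inl t.1.1) t.1.2.1 le_rfl hg
        (by simp only [lft, one_mul]; exact hwa) t.2.1 t.2.2
      refine ⟨z, Or.inr (Set.mem_iUnion.2 ⟨(t.1.1, t.1.2.2), hz, by rw [← hzw] at hw; exact hw⟩), ?_⟩
      obtain ⟨t', h1, h2, h3, h4⟩ := prod_main R C B _ _ z hz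
      rw [h1]
      congr 2
      apply Subtype.ext
      rw [hzw, hwa] at h4
      exact Prod.ext h2 (Prod.ext (Zt.arr_inj h4) h3)

theorem eval_zero : evalPath? (Rees.pre0 S R) (labL R C B) [none] = some zr := rfl

theorem triple_ext {t t' : Rees.Triples S R.F R.G} (h1 : t.1.1 = t'.1.1)
    (h2 : t.1.2.1 = t'.1.2.1) (h3 : t.1.2.2 = t'.1.2.2) : t = t' :=
  Subtype.ext (Prod.ext h1 (Prod.ext h2 h3))

theorem autoRel_vertex [Finite E] [Finite I] [Finite Λ] (hC : IsAutomaticStructure C) (hB hgood) :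
    AutoRel (relVertex (CM R C B hB hgood) ()) := by
  have h1 := AutoRel.prod (reg_singleton (none : Ltr R C B)) (reg_singleton (none : Ltr R C B))
  have h2 := AutoRel.iUnion (fun q : I × Λ =>
    autoRel_enc R C B (autoRel_eq C hC (R.G q.2)) q.1 q.2 q.2)
  have h := h1.union h2
  convert h using 1
  ext ⟨y, z⟩
  simp only [relVertex, Set.mem_ofPred_eq, Set.mem_union, Set.mem_prod, Set.mem_singleton_iff,
    Set.mem_iUnion]
  constructor
  · rintro ⟨hy, hz, _, he⟩
    change y ∈ KM R C B at hy
    change z ∈ KM R C B at hz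
    change evalPath? _ (labL R C B) y = evalPath? _ (labL R C B) z at he
    rcases hy with hy | hy <;> rcases hz with hz | hz
    · exact Or.inl ⟨hy, hz⟩
    · obtain ⟨q, hq, hqK⟩ := Set.mem_iUnion.1 hz
      obtain ⟨t, ht, _⟩ := prod_main R C B _ _ z hq
      rw [Set.mem_singleton_iff.1 hy, eval_zero, ht] at he
      exact absurd (Option.some.inj he).symm (mk_ne_zr _)
    · obtain ⟨q, hq, hqK⟩ := Set.mem_iUnion.1 hy
      obtain ⟨t, ht, _⟩ := prod_main R C B _ _ y hq
      rw [Set.mem_singleton_iff.1 hz, eval_zero, ht] at he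
      exact absurd (Option.some.inj he) (mk_ne_zr _)
    · obtain ⟨q, hq, hqK⟩ := Set.mem_iUnion.1 hy
      obtain ⟨q', hq', hqK'⟩ := Set.mem_iUnion.1 hz
      obtain ⟨t, ht, a1, a2, a3⟩ := prod_main R C B _ _ y hq
      obtain ⟨t', ht', b1, b2, b3⟩ := prod_main R C B _ _ z hq'
      rw [ht, ht'] at he
      have := mk_inj (Option.some.inj he)
      subst this
      have : q = q' := Prod.ext (a1.symm.trans b1) (a2.symm.trans b2)
      subst this
      refine Or.inr ⟨q, hq, hq', hqK, hqK', ?_, by rw [← a3, ← b3]⟩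
      obtain ⟨a, c1, _, c3⟩ := K_val C (show dec R C B y ∈ C.K from hqK)
      rw [c3, ← a2, ← t.2.2]
      rw [c1] at a3
      rw [Zt.arr_inj a3]
  · rintro (⟨rfl, rfl⟩ | ⟨q, hq, hq', hqK, hqK', -, hv⟩)
    · exact ⟨Or.inl rfl, Or.inl rfl, rfl, rfl⟩
    · obtain ⟨t, ht, a1, a2, a3⟩ := prod_main R C B _ _ y hq
      obtain ⟨t', ht', b1, b2, b3⟩ := prod_main R C B _ _ z hq'
      refine ⟨Or.inr (Set.mem_iUnion.2 ⟨q, hq, hqK⟩), Or.inr (Set.mem_iUnion.2 ⟨q, hq', hqK'⟩),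
        ?_, ?_⟩
      · simp [pathTgt?, List.getLast?_eq_getLast_of_ne_nil (Vld.ne_nil R C B hq)]
      · change evalPath? _ (labL R C B) y = evalPath? _ (labL R C B) z
        rw [ht, ht', triple_ext R (a1.trans b1.symm) (Zt.arr_inj (a3.trans (hv.trans b3.symm)))
          (a2.trans b2.symm)]

theorem mem_relEdge (hB hgood) (g : Ltr R C B) (y z) :
    (y, z) ∈ relEdge (CM R C B hB hgood) g ↔ y ∈ KM R C B ∧ z ∈ KM R C B ∧
      ∃ m, evalPath? (Rees.pre0 S R) (labL R C B) y = some m ∧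
        some (Rees.mul0 S R m (labL R C B g)) =
          evalPath? (Rees.pre0 S R) (labL R C B) z := by
  have hne : y ∈ KM R C B → y ≠ [] := fun h => ((CM R C B hB hgood).K_path y h).1
  constructor
  · rintro ⟨hy, hz, _, he⟩
    refine ⟨hy, hz, ?_⟩
    rcases hm : evalPath? (Rees.pre0 S R) (labL R C B) y with _ | m
    · have := hne hy
      cases y with
      | nil => simp at this
      | cons => simp [evalPath?] at hm
    · refine ⟨m, rfl, ?_⟩
      have he' : evalPath? (Rees.pre0 S R) (labL R C B) (y ++ [g]) =
        evalPath? (Rees.pre0 S R) (labL R C B) z := he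
      rw [evalPath_snoc _ _ hm] at he'
      exact he'
  · rintro ⟨hy, hz, m, hm, he⟩
    refine ⟨hy, hz, ?_, ?_⟩
    · simp [pathTgt?, List.getLast?_eq_getLast_of_ne_nil (hne hy)]
    · have : evalPath? (Rees.pre0 S R) (labL R C B) (y ++ [g]) =
        evalPath? (Rees.pre0 S R) (labL R C B) z := by
        rw [evalPath_snoc _ _ hm]
        exact he
      exact this

/-- Only the zero word represents zero. -/
theorem eval_zr_iff {z} (hz : z ∈ KM R C B) :
    some zr = evalPath? (Rees.pre0 S R) (labL R C B) z ↔ z = [none] := by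
  constructor
  · intro h
    rcases hz with hz | hz
    · exact hz
    · obtain ⟨q, hq, hqK⟩ := Set.mem_iUnion.1 hz
      obtain ⟨t, ht, _⟩ := prod_main R C B _ _ z hq
      rw [ht] at h
      exact absurd (Option.some.inj h).symm (mk_ne_zr _)
  · rintro rfl; rfl

theorem autoRel_edge [Finite E] [Finite I] [Finite Λ] (hC : IsAutomaticStructure C) (hB hgood)
    (g : Ltr R C B) : AutoRel (relEdge (CM R C B hB hgood) g) := by
  have hs := reg_singleton (none : Ltr R C B)
  have h0 : ([none] : List (Ltr R C B)) ∈ KM R C B := Or.inl rfl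
  rcases carrier_cases (labL R C B g) with hg | ⟨s, hg⟩
  · have h1 := AutoRel.prod (reg_KM R C B hC.2.1) hs
    convert h1 using 1
    ext ⟨y, z⟩
    rw [mem_relEdge, hg]
    simp only [mul_zr, Set.mem_prod, Set.mem_singleton_iff]
    constructor
    · rintro ⟨hy, hz, m, hm, he⟩
      exact ⟨hy, (eval_zr_iff R C B hz).1 he⟩
    · rintro ⟨hy, rfl⟩
      refine ⟨hy, h0, ?_⟩
      rcases hm : evalPath? (Rees.pre0 S R) (labL R C B) y with _ | m
      · have := ((CM R C B hB hgood).K_path y hy).1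
        cases y with
        | nil => simp at this
        | cons => simp [evalPath?] at hm
      · exact ⟨m, rfl, rfl⟩
  · -- the contribution of each pair of indices
    let T : I × Λ → Set (List (Ltr R C B) × List (Ltr R C B)) := fun q =>
      match R.P q.2 s.1.1 with
      | none => ({z | Vld R C B q.2 (.inl q.1) z} ∩ {z | dec R C B z ∈ C.K}) ×ˢ {[none]}
      | some p => {r | Vld R C B q.2 (.inl q.1) r.1 ∧ Vld R C B s.1.2.2 (.inl q.1) r.2 ∧
          (dec R C B r.1, dec R C B r.2) ∈ {r : List E × List E | r.1 ∈ C.K ∧ r.2 ∈ C.K ∧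
            val C r.1 * .arr (S.mul p s.1.2.1) = val C r.2}}
    have hT : ∀ q, AutoRel (T q) := by
      intro q
      simp only [T]
      rcases R.P q.2 s.1.1 with _ | p
      · exact AutoRel.prod (reg_part R C B hC.2.1 q) hs
      · exact autoRel_enc R C B (autoRel_mul C hC _) _ _ _
    have h := (AutoRel.prod hs hs).union (AutoRel.iUnion hT)
    convert h using 1
    ext ⟨y, z⟩
    rw [mem_relEdge, hg]
    simp only [Set.mem_union, Set.mem_prod, Set.mem_singleton_iff, Set.mem_iUnion]
    have hmain : ∀ q : I × Λ, Vld R C B q.2 (.inl q.1) y → dec R C B y ∈ C.K →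
        ((z ∈ KM R C B ∧ ∃ m, evalPath? (Rees.pre0 S R) (labL R C B) y = some m ∧
          some (Rees.mul0 S R m (mk s)) = evalPath? (Rees.pre0 S R) (labL R C B) z) ↔
          (y, z) ∈ T q) := by
      intro q hq hqK
      obtain ⟨t, ht, a1, a2, a3⟩ := prod_main R C B _ _ y hq
      have hm : (∃ m, evalPath? (Rees.pre0 S R) (labL R C B) y = some m ∧
          some (Rees.mul0 S R m (mk s)) = evalPath? (Rees.pre0 S R) (labL R C B) z) ↔
          some (Rees.mul0 S R (mk t) (mk s)) = evalPath? (Rees.pre0 S R) (labL R C B) z := by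
        constructor
        · rintro ⟨m, hm, he⟩
          rw [ht] at hm
          rw [Option.some.inj hm]; exact he
        · intro he; exact ⟨_, ht, he⟩
      rw [hm]
      simp only [T]
      rcases hP : R.P q.2 s.1.1 with _ | p
      · rw [mul0_none (by rw [a2]; exact hP)]
        constructor
        · rintro ⟨hz, he⟩
          exact ⟨⟨hq, hqK⟩, (eval_zr_iff R C B hz).1 he⟩
        · rintro ⟨-, hz⟩
          have hz : z = [none] := hz
          subst hz
          exact ⟨h0, rfl⟩
      · obtain ⟨u, hu, hu'⟩ := mul0_some (R := R) (t := t) (t' := s) (p := p)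
          (by rw [a2]; exact hP)
        rw [hu]
        have e1 : S.tgt t.1.2.1 = S.src p := by
          rw [R.P_src _ _ _ hP, ← a2]; exact t.2.2
        have e2 : S.tgt p = S.src s.1.2.1 := by
          rw [R.P_tgt _ _ _ hP]; exact s.2.1
        have e3 : (.arr u.1.2.1 : Zt S) = val C (dec R C B y) * .arr (S.mul p s.1.2.1) := by
          rw [hu', S.mul_assoc' _ _ _ e1 e2, ← a3, Zt.arr_mul]
          rw [S.src_mul _ _ e2, e1]
        constructor
        · rintro ⟨hz, he⟩
          rcases hz with hz | hz
          · rw [Set.mem_singleton_iff.1 hz, eval_zero] at he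
            exact absurd (Option.some.inj he) (mk_ne_zr _)
          · obtain ⟨q', hq', hqK'⟩ := Set.mem_iUnion.1 hz
            obtain ⟨t', ht', b1, b2, b3⟩ := prod_main R C B _ _ z hq'
            rw [ht'] at he
            have := mk_inj (Option.some.inj he)
            subst this
            have c1 : q'.1 = q.1 := by rw [← b1, hu', ← a1]
            have c2 : q'.2 = s.1.2.2 := by rw [← b2, hu']
            rw [c1, c2] at hq'
            exact ⟨hq, hq', hqK, hqK', by rw [← e3, b3]⟩
        · rintro ⟨-, hq', -, hqK', hv⟩
          obtain ⟨t', ht', b1, b2, b3⟩ := prod_main R C B _ _ z hq'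
          refine ⟨Or.inr (Set.mem_iUnion.2 ⟨(q.1, s.1.2.2), hq', hqK'⟩), ?_⟩
          rw [ht', triple_ext R (t := u) (t' := t')]
          · rw [b1, hu', a1]
          · exact Zt.arr_inj (e3.trans (hv.trans b3.symm))
          · rw [b2, hu']
    constructor
    · rintro ⟨hy, hz, hm⟩
      rcases hy with hy | hy
      · obtain ⟨m, hm, he⟩ := hm
        rw [Set.mem_singleton_iff.1 hy, eval_zero] at hm
        rw [← Option.some.inj hm, zr_mul] at he
        exact Or.inl ⟨hy, (eval_zr_iff R C B hz).1 he⟩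
      · obtain ⟨q, hq, hqK⟩ := Set.mem_iUnion.1 hy
        exact Or.inr ⟨q, (hmain q hq hqK).1 ⟨hz, hm⟩⟩
    · rintro (⟨rfl, rfl⟩ | ⟨q, hq⟩)
      · exact ⟨h0, h0, zr, rfl, by rw [zr_mul]; rfl⟩
      · have hv : Vld R C B q.2 (.inl q.1) y ∧ dec R C B y ∈ C.K := by
          simp only [T] at hq
          rcases hP : R.P q.2 s.1.1 with _ | p
          · rw [hP] at hq
            exact hq.1
          · rw [hP] at hq
            exact ⟨hq.1, hq.2.2.1⟩
        exact ⟨Or.inr (Set.mem_iUnion.2 ⟨q, hv⟩), (hmain q hv.1 hv.2).2 hq⟩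

end Enc

/-- Theorem 4.4: a finitely generated Rees matrix semigroup with zero over an
automatic semigroupoid is automatic. -/
theorem stmt_8 {O A I Λ : Type} (S : Sgpd O A) (hne : Nonempty A)
    (hiso : IsolationFree S.toPreSgpd)
    (R : Rees.Data0 S I Λ)
    (hS : IsAutomatic S.toPreSgpd)
    (hfg : IsFG (Rees.pre0 S R)) :
    IsAutomatic (Rees.pre0 S R) := by
  obtain ⟨E, C, hC⟩ := hS
  obtain ⟨hI, hL, hfin⟩ := fg_finite hfg
  obtain ⟨B, hB, hgood⟩ := exists_good R C hC.2.1 hfin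
  have hE : Finite E := hC.1
  have := blk_finite R C B
  have := rmd_finite (E := E) B
  refine ⟨Ltr R C B, CM R C B hB hgood, inferInstance, reg_KM R C B hC.2.1, ?_, ?_⟩
  · intro g
    refine sync_of_autoRel (autoRel_edge R C B hC hB hgood g) ?_
    rintro p ⟨h1, h2, _⟩
    exact ⟨((CM R C B hB hgood).K_path _ h1).1, ((CM R C B hB hgood).K_path _ h2).1⟩
  · rintro ⟨⟩
    refine sync_of_autoRel (autoRel_vertex R C B hC hB hgood) ?_
    rintro p ⟨h1, h2, _⟩
    exact ⟨((CM R C B hB hgood).K_path _ h1).1, ((CM R C B hB hgood).K_path _ h2).1⟩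

end AutoRees
end

section
/- Let M = M^0(S; F(I), G(Lambda); P) be a Rees matrix semigroup with zero over a semigroupoid S. If (i) the indexing sets I and Lambda are finite, (ii) the semigroupoid S is automatic, and (iii) S^1 \ (S P' S) is finite, where P' is the set of non-zero entries of the sandwich matrix P and S P' S is the set of arrows of the form s p t with s, t ∈ S^1 and p ∈ P', then M is an automatic semigroup. -/
/- Common framework: graphs, path languages, synchronous regularity,
   semigroupoids, automatic structures, and Rees matrix constructions. -/

namespace AutoRees

variable {O A E : Type} {S : PreSgpd O A}

namespace Pf

theorem reg_iff {α : Type} {L : Set (List α)} : IsRegularSet L ↔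
    ∃ (σ : Type) (_ : Finite σ) (f : List α → σ),
      (∀ l l' a, f l = f l' → f (l ++ [a]) = f (l' ++ [a])) ∧
      ∃ acc : Set σ, ∀ l, l ∈ L ↔ f l ∈ acc := by
  constructor
  · rintro ⟨σ, hσ, M, hM⟩
    refine ⟨σ, inferInstance, M.eval, ?_, M.accept, ?_⟩
    · intro l l' a h
      rw [DFA.eval_append_singleton, DFA.eval_append_singleton, h]
    · intro l
      have : l ∈ M.accepts ↔ M.eval l ∈ M.accept := DFA.mem_accepts _
      rw [hM] at this
      exact this
  · rintro ⟨σ, hσ, f, hs, acc, hacc⟩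
    have key : ∀ m l l', f l = f l' → f (l ++ m) = f (l' ++ m) := by
      intro m
      induction m using List.reverseRecOn with
      | nil => intro l l' h; simpa using h
      | append_singleton m a ih =>
        intro l l' h
        rw [← List.append_assoc, ← List.append_assoc]
        exact hs _ _ _ (ih _ _ h)
    apply Language.IsRegular.of_finite_range_leftQuotient
    have : ∀ x, Language.leftQuotient (show Language α from L) x =
        (fun s : σ => ({ y | ∃ l, f l = s ∧ l ++ y ∈ L } : Set (List α))) (f x) := by
      intro x
      apply Set.ext
      intro y
      constructor
      · intro h
        exact ⟨x, rfl, h⟩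
      · rintro ⟨l, hl, hy⟩
        show x ++ y ∈ L
        rw [hacc] at hy ⊢
        rwa [← key y l x hl]
    have h2 : Set.range (Language.leftQuotient (show Language α from L)) ⊆
        Set.range (fun s : σ => ({ y | ∃ l, f l = s ∧ l ++ y ∈ L } : Set (List α))) := by
      rintro _ ⟨x, rfl⟩
      exact ⟨f x, (this x).symm⟩
    exact (Set.finite_range _).subset h2

theorem key_append {α σ : Type} {f : List α → σ}
    (hs : ∀ l l' a, f l = f l' → f (l ++ [a]) = f (l' ++ [a])) :
    ∀ m l l', f l = f l' → f (l ++ m) = f (l' ++ m) := by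
  intro m
  induction m using List.reverseRecOn with
  | nil => intro l l' h; simpa using h
  | append_singleton m a ih =>
    intro l l' h
    rw [← List.append_assoc, ← List.append_assoc]
    exact hs _ _ _ (ih _ _ h)

section
variable {α β : Type}

theorem reg_inter {L M : Set (List α)} (hL : IsRegularSet L) (hM : IsRegularSet M) :
    IsRegularSet (L ∩ M) := by
  rw [reg_iff] at *
  obtain ⟨σ, _, f, hf, A, hA⟩ := hL
  obtain ⟨τ, _, g, hg, B, hB⟩ := hM
  refine ⟨σ × τ, inferInstance, fun l => (f l, g l), ?_, {s | s.1 ∈ A ∧ s.2 ∈ B}, ?_⟩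
  · intro l l' a h
    simp only [Prod.mk.injEq] at h ⊢
    exact ⟨hf _ _ _ h.1, hg _ _ _ h.2⟩
  · intro l
    simp [hA, hB]

theorem reg_union {L M : Set (List α)} (hL : IsRegularSet L) (hM : IsRegularSet M) :
    IsRegularSet (L ∪ M) := by
  rw [reg_iff] at *
  obtain ⟨σ, _, f, hf, A, hA⟩ := hL
  obtain ⟨τ, _, g, hg, B, hB⟩ := hM
  refine ⟨σ × τ, inferInstance, fun l => (f l, g l), ?_, {s | s.1 ∈ A ∨ s.2 ∈ B}, ?_⟩
  · intro l l' a h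
    simp only [Prod.mk.injEq] at h ⊢
    exact ⟨hf _ _ _ h.1, hg _ _ _ h.2⟩
  · intro l
    simp [hA, hB]

theorem reg_empty : IsRegularSet (∅ : Set (List α)) := by
  rw [reg_iff]
  exact ⟨Unit, inferInstance, fun _ => (), fun _ _ _ _ => rfl, ∅, by simp⟩

theorem reg_iUnion {ι : Type} [Finite ι] {L : ι → Set (List α)} (h : ∀ i, IsRegularSet (L i)) :
    IsRegularSet (⋃ i, L i) := by
  have hx : ∀ i, _ := fun i => reg_iff.1 (h i)
  choose σ hσ f hf A hA using hx
  refine reg_iff.2 ⟨∀ i, σ i, inferInstance, fun l i => f i l, ?_, {s | ∃ i, s i ∈ A i}, ?_⟩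
  · intro l l' a h
    funext i
    exact hf i _ _ _ (congrFun h i)
  · intro l
    simp [hA]

theorem reg_hom (h : α → List β) {L : Set (List β)} (hL : IsRegularSet L) :
    IsRegularSet {w : List α | w.flatMap h ∈ L} := by
  rw [reg_iff] at *
  obtain ⟨σ, _, f, hf, A, hA⟩ := hL
  refine ⟨σ, inferInstance, fun w => f (w.flatMap h), ?_, A, fun l => hA _⟩
  intro l l' a e
  simp only [List.flatMap_append]
  exact key_append hf _ _ _ e

theorem reg_comap (h : α → β) {L : Set (List β)} (hL : IsRegularSet L) :
    IsRegularSet {w : List α | w.map h ∈ L} := by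
  rw [reg_iff] at *
  obtain ⟨σ, _, f, hf, A, hA⟩ := hL
  refine ⟨σ, inferInstance, fun w => f (w.map h), ?_, A, fun l => hA _⟩
  intro l l' a e
  simp only [List.map_append]
  exact key_append hf _ _ _ e

theorem reg_image (h : α → β) {L : Set (List α)} (hL : IsRegularSet L) :
    IsRegularSet {w : List β | ∃ l ∈ L, w = l.map h} := by
  rw [reg_iff] at *
  obtain ⟨σ, _, f, hf, A, hA⟩ := hL
  refine ⟨Set σ, inferInstance, fun w => {s | ∃ l, w = l.map h ∧ f l = s}, ?_,
    {T | ∃ s ∈ T, s ∈ A}, ?_⟩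
  · have key : ∀ w w' : List β, ∀ b, {s | ∃ l, w = l.map h ∧ f l = s} =
        {s | ∃ l, w' = l.map h ∧ f l = s} →
        {s | ∃ l, w ++ [b] = l.map h ∧ f l = s} ⊆ {s | ∃ l, w' ++ [b] = l.map h ∧ f l = s} := by
      rintro w w' b e s ⟨l, hl, rfl⟩
      obtain ⟨l1, l2, rfl, h1, h2⟩ := List.map_eq_append_iff.1 hl.symm
      obtain ⟨a, rfl, ha⟩ := List.map_eq_singleton_iff.1 h2
      have : f l1 ∈ {s | ∃ l, w = l.map h ∧ f l = s} := ⟨l1, h1.symm, rfl⟩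
      rw [e] at this
      obtain ⟨l', hl', hs⟩ := this
      exact ⟨l' ++ [a], by simp [hl', ha], hf _ _ _ hs⟩
    intro w w' b e
    exact Set.Subset.antisymm (key _ _ _ e) (key _ _ _ e.symm)
  · intro w
    constructor
    · rintro ⟨l, hl, rfl⟩
      exact ⟨f l, ⟨l, rfl, rfl⟩, (hA l).1 hl⟩
    · rintro ⟨_, ⟨l, hl, rfl⟩, h⟩
      exact ⟨l, (hA l).2 h, hl⟩

theorem reg_quot (c : α) {L : Set (List α)} (hL : IsRegularSet L) :
    IsRegularSet {w : List α | ∃ n, w ++ List.replicate n c ∈ L} := by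
  rw [reg_iff] at *
  obtain ⟨σ, _, f, hf, A, hA⟩ := hL
  refine ⟨σ, inferInstance, f, hf, {s | ∃ w n, f w = s ∧ f (w ++ List.replicate n c) ∈ A}, ?_⟩
  intro l
  constructor
  · rintro ⟨n, hn⟩
    exact ⟨l, n, rfl, (hA _).1 hn⟩
  · rintro ⟨w, n, hw, h⟩
    refine ⟨n, (hA _).2 ?_⟩
    rwa [← key_append hf _ _ _ hw]

theorem reg_padstar (c : α) {L : Set (List α)} (hL : IsRegularSet L) :
    IsRegularSet {w : List α | ∃ l ∈ L, ∃ n, w = l ++ List.replicate n c} := by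
  rw [reg_iff] at *
  obtain ⟨σ, _, f, hf, A, hA⟩ := hL
  have step : ∀ w a, (∃ l ∈ L, ∃ n, w ++ [a] = l ++ List.replicate n c) ↔
      (f (w ++ [a]) ∈ A ∨ (a = c ∧ ∃ l ∈ L, ∃ n, w = l ++ List.replicate n c)) := by
    intro w a
    constructor
    · rintro ⟨l, hl, n, h⟩
      cases n with
      | zero => left; rw [h]; simpa using (hA l).1 hl
      | succ n =>
        right
        rw [List.replicate_succ', ← List.append_assoc] at h
        obtain ⟨h1, h2⟩ := List.append_inj' h rfl
        exact ⟨by simpa using h2, l, hl, n, h1⟩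
    · rintro (h | ⟨rfl, l, hl, n, rfl⟩)
      · exact ⟨w ++ [a], (hA _).2 h, 0, by simp⟩
      · exact ⟨l, hl, n + 1, by rw [List.replicate_succ', List.append_assoc]⟩
  refine ⟨σ × Prop, inferInstance, fun w => (f w, ∃ l ∈ L, ∃ n, w = l ++ List.replicate n c),
    ?_, {s | s.2}, fun l => Iff.rfl⟩
  intro l l' a h
  simp only [Prod.mk.injEq] at h ⊢
  have := hf _ _ a h.1
  refine ⟨this, ?_⟩
  rw [step, step, this, h.2]

theorem reg_ends [Finite α] (φ : Option α → Option α → Prop) :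
    IsRegularSet {l : List α | φ l.head? l.getLast?} := by
  rw [reg_iff]
  refine ⟨Option α × Option α, inferInstance, fun l => (l.head?, l.getLast?), ?_,
    {s | φ s.1 s.2}, fun l => Iff.rfl⟩
  intro l l' a h
  simp only [Prod.mk.injEq] at h ⊢
  simp [List.head?_append, h.1]

theorem reg_chain [Finite α] (r : α → α → Prop) :
    IsRegularSet {l : List α | l.IsChain r} := by
  rw [reg_iff]
  refine ⟨Option α × Prop, inferInstance, fun l => (l.getLast?, l.IsChain r), ?_,
    {s | s.2}, fun l => Iff.rfl⟩
  intro l l' a h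
  simp only [Prod.mk.injEq] at h ⊢
  simp [List.isChain_append, h.1, h.2]

theorem reg_singleton [Finite α] (a : α) : IsRegularSet {l : List α | l = [a]} := by
  rw [reg_iff]
  refine ⟨Option α × Fin 3, inferInstance,
    fun l => (l.head?, ⟨min l.length 2, by omega⟩), ?_, {s | s.1 = some a ∧ s.2 = 1}, ?_⟩
  · intro l l' b h
    simp only [Prod.mk.injEq, Fin.mk.injEq] at h ⊢
    simp only [List.head?_append, h.1, List.length_append, List.length_singleton, true_and]
    omega
  · intro l
    rcases l with _ | ⟨x, _ | ⟨y, l⟩⟩ <;> simp [Fin.ext_iff]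

end

/-! ### padded words -/

def IsPad {E : Type} (a : List E) (w : List (Option E)) : Prop :=
  ∃ k, w = a.map some ++ List.replicate k none

theorem IsPad.uniq {E : Type} {a b : List E} {w : List (Option E)} (h : IsPad a w)
    (h' : IsPad b w) : a = b := by
  obtain ⟨k, rfl⟩ := h
  obtain ⟨l, h⟩ := h'
  have := congrArg (List.filterMap id) h
  simpa [List.filterMap_append, List.filterMap_map] using this

def PR {E : Type} (R : Set (List E × List E)) : Set (List (Option E × Option E)) :=
  {w | ∃ a b, (a, b) ∈ R ∧ IsPad a (w.map Prod.fst) ∧ IsPad b (w.map Prod.snd)}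

def cv {E : Type} : List E → List E → List (Option E × Option E)
  | [], [] => []
  | x :: a, [] => (some x, none) :: cv a []
  | [], y :: b => (none, some y) :: cv [] b
  | x :: a, y :: b => (some x, some y) :: cv a b

theorem isPad_nil_left {E : Type} {w : List (Option E)} : IsPad ([] : List E) w ↔
    ∃ k, w = List.replicate k none := by simp [IsPad]

theorem isPad_cons {E : Type} {x : E} {a : List E} {y : Option E} {w : List (Option E)} :
    IsPad (x :: a) (y :: w) ↔ y = some x ∧ IsPad a w := by
  simp [IsPad]

theorem isPad_nil_cons {E : Type} {y : Option E} {w : List (Option E)} :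
    IsPad ([] : List E) (y :: w) ↔ y = none ∧ IsPad [] w := by
  simp only [isPad_nil_left]
  constructor
  · rintro ⟨k, h⟩
    cases k with
    | zero => simp at h
    | succ k => simp [List.replicate_succ] at h; exact ⟨h.1, k, h.2⟩
  · rintro ⟨rfl, k, rfl⟩
    exact ⟨k + 1, rfl⟩

theorem isPad_nil_right {E : Type} {a : List E} : IsPad a [] ↔ a = [] := by
  constructor
  · rintro ⟨k, h⟩
    have := congrArg List.length h
    simp at this
    exact List.length_eq_zero_iff.1 (by omega)
  · rintro rfl
    exact ⟨0, rfl⟩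

theorem pad_iff_cv {E : Type} : ∀ (w : List (Option E × Option E)) (a b : List E),
    (IsPad a (w.map Prod.fst) ∧ IsPad b (w.map Prod.snd)) ↔
      ∃ n, w = cv a b ++ List.replicate n (none, none)
  | [], a, b => by
    simp only [List.map_nil, isPad_nil_right]
    rcases a with _ | ⟨x, a⟩ <;> rcases b with _ | ⟨y, b⟩ <;> simp [cv]
  | (p, q) :: w, [], [] => by
    have := pad_iff_cv w [] []
    simp only [List.map_cons, isPad_nil_cons]
    rw [show ((p = none ∧ IsPad [] (w.map Prod.fst)) ∧ (q = none ∧ IsPad [] (w.map Prod.snd))) ↔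
      (p = none ∧ q = none ∧ (IsPad [] (w.map Prod.fst) ∧ IsPad [] (w.map Prod.snd))) by tauto,
      this]
    simp only [cv, List.nil_append]
    constructor
    · rintro ⟨rfl, rfl, n, rfl⟩
      exact ⟨n + 1, rfl⟩
    · rintro ⟨n, h⟩
      cases n with
      | zero => simp at h
      | succ n => simp [List.replicate_succ] at h; exact ⟨h.1.1, h.1.2, n, h.2⟩
  | (p, q) :: w, x :: a, [] => by
    have := pad_iff_cv w a []
    simp only [List.map_cons, isPad_nil_cons, isPad_cons, cv, List.cons_append, List.cons.injEq,
      Prod.mk.injEq, exists_and_left, ← this]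
    tauto
  | (p, q) :: w, [], y :: b => by
    have := pad_iff_cv w [] b
    simp only [List.map_cons, isPad_nil_cons, isPad_cons, cv, List.cons_append, List.cons.injEq,
      Prod.mk.injEq, exists_and_left, ← this]
    tauto
  | (p, q) :: w, x :: a, y :: b => by
    have := pad_iff_cv w a b
    simp only [List.map_cons, isPad_nil_cons, isPad_cons, cv, List.cons_append, List.cons.injEq,
      Prod.mk.injEq, exists_and_left, ← this]
    tauto

def deltaGen {V E : Type} (p q : E ⊕ Option V) (a b : List E) :
    List ((E ⊕ Option V) × (E ⊕ Option V)) :=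
  (a.map Sum.inl).zip (b.map Sum.inl) ++
    (if a.length ≤ b.length
      then (b.drop a.length).map (fun e => (p, Sum.inl e))
      else (a.drop b.length).map (fun e => (Sum.inl e, q)))

theorem deltaGen_eq {V E : Type} (p q : E ⊕ Option V) : ∀ (a b : List E),
    deltaGen p q a b = (cv a b).map (fun z => (z.1.elim p Sum.inl, z.2.elim q Sum.inl))
  | [], [] => by simp [deltaGen, cv]
  | x :: a, [] => by
    have := deltaGen_eq p q a []
    rw [cv, List.map_cons, ← this]
    rcases a with _ | ⟨y, a⟩ <;> simp [deltaGen]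
  | [], y :: b => by
    have := deltaGen_eq p q [] b
    rw [cv, List.map_cons, ← this]
    simp [deltaGen]
  | x :: a, y :: b => by
    have := deltaGen_eq p q a b
    rw [cv, List.map_cons, ← this]
    simp [deltaGen]

theorem deltaPair_eq {V E : Type} (t : E → V) (a b : List E) :
    deltaPair t a b =
      (cv a b).map (fun z => (z.1.elim (padSym t a) Sum.inl, z.2.elim (padSym t b) Sum.inl)) :=
  deltaGen_eq _ _ a b

theorem cv_ne {E : Type} : ∀ (a b : List E), ∀ z ∈ cv a b, z ≠ (none, none)
  | [], [] => by simp [cv]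
  | x :: a, [] => by simpa [cv] using fun p q h => by simpa using cv_ne a [] (p, q) h
  | [], y :: b => by simpa [cv] using fun p q h => by simpa using cv_ne [] b (p, q) h
  | x :: a, y :: b => by simpa [cv] using fun p q h => by simpa using cv_ne a b (p, q) h

theorem PR_of_sync {V E : Type} {t : E → V} {R : Set (List E × List E)}
    (h : SyncRegular t R) : IsRegularSet (PR R) := by
  have := reg_padstar (none, none) (reg_image
    (fun z : (E ⊕ Option V) × (E ⊕ Option V) => (z.1.getLeft?, z.2.getLeft?)) h)
  convert this using 1
  ext w
  have er : ∀ a b : List E, cv a b = (deltaPair t a b).map (fun z => (z.1.getLeft?, z.2.getLeft?)) := by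
    intro a b
    rw [deltaPair_eq, List.map_map]
    conv_lhs => rw [← List.map_id (cv a b)]
    apply List.map_congr_left
    rintro ⟨p, q⟩ -
    rcases p with _ | p <;> rcases q with _ | q <;> simp [padSym]
  constructor
  · rintro ⟨a, b, hR, hp⟩
    obtain ⟨n, hn⟩ := (pad_iff_cv w a b).1 hp
    exact ⟨_, ⟨_, ⟨(a, b), hR, rfl⟩, rfl⟩, n, by rw [hn, er a b]⟩
  · rintro ⟨_, ⟨_, ⟨⟨a, b⟩, hR, rfl⟩, rfl⟩, n, rfl⟩
    refine ⟨a, b, hR, (pad_iff_cv _ a b).2 ⟨n, by rw [er a b]⟩⟩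

theorem sync_of_PR {E : Type} [Finite E] {t : E → Unit} {R : Set (List E × List E)}
    (hne : ∀ p ∈ R, p.1 ≠ [] ∧ p.2 ≠ [])
    (h : IsRegularSet (PR R)) : SyncRegular t R := by
  have := reg_image
    (fun z : Option E × Option E => ((z.1.elim (Sum.inr (some ())) Sum.inl,
      z.2.elim (Sum.inr (some ())) Sum.inl) : (E ⊕ Option Unit) × (E ⊕ Option Unit)))
    (reg_inter h (reg_ends (fun _ l => l ≠ some (none, none))))
  unfold SyncRegular
  convert this using 1
  ext w
  have er : ∀ a : List E, a ≠ [] → padSym t a = Sum.inr (some ()) := by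
    intro a ha
    rw [padSym, List.getLast?_eq_some_getLast ha]
    rfl
  constructor
  · rintro ⟨⟨a, b⟩, hR, rfl⟩
    refine ⟨cv a b, ⟨⟨a, b, hR, (pad_iff_cv _ _ _).2 ⟨0, by simp⟩⟩, ?_⟩, ?_⟩
    · show (cv a b).getLast? ≠ some (none, none)
      intro hl
      exact cv_ne a b _ (List.mem_of_getLast? hl) rfl
    · rw [deltaPair_eq, er _ (hne _ hR).1, er _ (hne _ hR).2]
  · rintro ⟨l, ⟨⟨a, b, hR, hp⟩, hl⟩, rfl⟩
    obtain ⟨n, rfl⟩ := (pad_iff_cv _ _ _).1 hp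
    refine ⟨(a, b), hR, ?_⟩
    cases n with
    | zero => rw [deltaPair_eq, er _ (hne _ hR).1, er _ (hne _ hR).2]; simp
    | succ n =>
      exfalso
      apply hl
      rw [List.replicate_succ', ← List.append_assoc]
      simp

theorem reg_padL {E : Type} {L : Set (List E)} (h : IsRegularSet L) :
    IsRegularSet {w : List (Option E) | ∃ a ∈ L, IsPad a w} := by
  have := reg_padstar none (reg_image some h)
  convert this using 1
  ext w
  constructor
  · rintro ⟨a, ha, k, rfl⟩
    exact ⟨_, ⟨a, ha, rfl⟩, k, rfl⟩
  · rintro ⟨_, ⟨a, ha, rfl⟩, k, rfl⟩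
    exact ⟨a, ha, k, rfl⟩

theorem PR_prod {E : Type} {L M : Set (List E)} (hL : IsRegularSet L) (hM : IsRegularSet M) :
    IsRegularSet (PR {p : List E × List E | p.1 ∈ L ∧ p.2 ∈ M}) := by
  convert reg_inter (reg_comap Prod.fst (reg_padL hL)) (reg_comap Prod.snd (reg_padL hM)) using 1
  ext w
  constructor
  · rintro ⟨a, b, ⟨ha, hb⟩, h1, h2⟩
    exact ⟨⟨a, ha, h1⟩, ⟨b, hb, h2⟩⟩
  · rintro ⟨⟨a, ha, h1⟩, ⟨b, hb, h2⟩⟩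
    exact ⟨a, b, ⟨ha, hb⟩, h1, h2⟩

theorem IsPad.append {E : Type} {a : List E} {w : List (Option E)} (h : IsPad a w) (n : ℕ) :
    IsPad a (w ++ List.replicate n none) := by
  obtain ⟨k, rfl⟩ := h
  exact ⟨k + n, by simp⟩

theorem IsPad.of_append {E : Type} {w : List (Option E)} {n : ℕ} :
    ∀ {a : List E}, IsPad a (w ++ List.replicate n none) → IsPad a w := by
  induction w with
  | nil =>
    intro a h
    have : IsPad a ([] ++ List.replicate n none) := h
    have h2 : IsPad ([] : List E) ([] ++ List.replicate n none) := ⟨n, by simp⟩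
    rw [this.uniq h2]
    exact ⟨0, rfl⟩
  | cons y w ih =>
    intro a h
    rcases a with _ | ⟨x, a⟩
    · rw [List.cons_append, isPad_nil_cons] at h
      exact isPad_nil_cons.2 ⟨h.1, ih h.2⟩
    · rw [List.cons_append, isPad_cons] at h
      exact isPad_cons.2 ⟨h.1, ih h.2⟩

theorem PR_comp {E : Type} {R1 R2 : Set (List E × List E)}
    (h1 : IsRegularSet (PR R1)) (h2 : IsRegularSet (PR R2)) :
    IsRegularSet (PR {p : List E × List E | ∃ b, (p.1, b) ∈ R1 ∧ (b, p.2) ∈ R2}) := by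
  have T := reg_inter
    (reg_comap (fun z : Option E × Option E × Option E => (z.1, z.2.1)) h1)
    (reg_comap (fun z : Option E × Option E × Option E => (z.2.1, z.2.2)) h2)
  have := reg_quot (none, none) (reg_image
    (fun z : Option E × Option E × Option E => (z.1, z.2.2)) T)
  convert this using 1
  ext w
  constructor
  · rintro ⟨a, c, ⟨b, hab, hbc⟩, ha, hc⟩
    obtain ⟨N, hN⟩ : ∃ N, w.length ≤ N ∧ b.length ≤ N := ⟨max w.length b.length, by simp⟩
    obtain ⟨n, hn⟩ : ∃ n, w.length + n = N := ⟨N - w.length, by omega⟩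
    obtain ⟨m, hm⟩ : ∃ m, b.length + m = N := ⟨N - b.length, by omega⟩
    obtain ⟨w', hw'⟩ : ∃ w', w ++ List.replicate n (none, none) = w' := ⟨_, rfl⟩
    have ha' := ha.append n
    have hc' := hc.append n
    have e1 : ((w ++ List.replicate n (none, none)).map Prod.fst) =
        w.map Prod.fst ++ List.replicate n none := by simp
    have e2 : ((w ++ List.replicate n (none, none)).map Prod.snd) =
        w.map Prod.snd ++ List.replicate n none := by simp
    have hb : IsPad b (b.map some ++ List.replicate m none) := ⟨m, rfl⟩
    rw [← e1] at ha'
    rw [← e2] at hc'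
    have lw : (w ++ List.replicate n (none, none)).length = N := by simp [hn]
    have lb : (b.map some ++ List.replicate m none).length = N := by simp [hm]
    rw [hw'] at ha' hc' lw
    generalize b.map some ++ List.replicate m none = bb at *
    have z1 : (w'.zip bb).map Prod.fst = w' := List.map_fst_zip (by omega)
    have z2 : (w'.zip bb).map Prod.snd = bb := List.map_snd_zip (by omega)
    refine ⟨n, (w'.zip bb).map (fun z => (z.1.1, z.2, z.1.2)), ⟨⟨a, b, hab, ?_, ?_⟩,
      ⟨b, c, hbc, ?_, ?_⟩⟩, ?_⟩
    · rw [← z1] at ha'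
      simpa [List.map_map, Function.comp_def] using ha'
    · rw [← z2] at hb
      simpa [List.map_map, Function.comp_def] using hb
    · rw [← z2] at hb
      simpa [List.map_map, Function.comp_def] using hb
    · rw [← z1] at hc'
      simpa [List.map_map, Function.comp_def] using hc'
    · simpa [List.map_map, Function.comp_def] using hw'.trans z1.symm
  · rintro ⟨n, l, ⟨⟨a, b, hab, ha, hb⟩, ⟨b', c, hbc, hb', hc⟩⟩, hl⟩
    have hbb : b = b' := by
      apply hb.uniq
      simpa [List.map_map, Function.comp_def] using hb'
    subst hbb
    have e1 := congrArg (List.map Prod.fst) hl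
    have e2 := congrArg (List.map Prod.snd) hl
    simp only [List.map_append, List.map_replicate, List.map_map, Function.comp_def] at e1 e2
    refine ⟨a, c, ⟨b, hab, hbc⟩, IsPad.of_append (n := n) ?_, IsPad.of_append (n := n) ?_⟩
    · rw [e1]
      simpa [List.map_map, Function.comp_def] using ha
    · rw [e2]
      simpa [List.map_map, Function.comp_def] using hc

theorem PR_mono_eq {E : Type} {R1 R2 : Set (List E × List E)} (h : R1 = R2)
    (h1 : IsRegularSet (PR R1)) : IsRegularSet (PR R2) := h ▸ h1

theorem PR_iUnion {E ι : Type} [Finite ι] {R : ι → Set (List E × List E)}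
    (h : ∀ i, IsRegularSet (PR (R i))) : IsRegularSet (PR (⋃ i, R i)) := by
  convert reg_iUnion h using 1
  ext w
  simp only [PR, Set.mem_iUnion, Set.mem_ofPred_eq]
  constructor
  · rintro ⟨a, b, ⟨i, hi⟩, h⟩
    exact ⟨i, a, b, hi, h⟩
  · rintro ⟨i, a, b, hi, h⟩
    exact ⟨a, b, ⟨i, hi⟩, h⟩

/-- pad a block to length `B` -/
def padB {E : Type} (B : ℕ) (l : List E) : List (Option E) :=
  l.map some ++ List.replicate (B - l.length) none

theorem padB_length {E : Type} {B : ℕ} {l : List E} (h : l.length ≤ B) :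
    (padB B l).length = B := by simp [padB]; omega

/-- the decoding condition: all pieces have length `B`, except the last which is at most `B` -/
def Good {T E : Type} (B : ℕ) (h : T → List E) : List T → Prop
  | [] => True
  | x :: l => (h x).length ≤ B ∧ (l ≠ [] → (h x).length = B) ∧ Good B h l

theorem good_pad {T E : Type} (B : ℕ) (h : T → List E) : ∀ {a : List T} {w : List (Option T)},
    Good B h a → IsPad a w →
    IsPad (a.flatMap h) (w.flatMap (fun x => padB B (x.elim [] h)))
  | [], w, _, hp => by
    obtain ⟨k, rfl⟩ := isPad_nil_left.1 hp
    refine isPad_nil_left.2 ⟨k * B, ?_⟩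
    induction k with
    | zero => simp
    | succ k ih =>
      rw [List.replicate_succ, List.flatMap_cons, ih ⟨k, by simp⟩]
      simp [padB]
      ring
  | x :: a, [], _, hp => by simp [isPad_nil_right] at hp
  | x :: a, y :: w, hg, hp => by
    obtain ⟨rfl, hp'⟩ := isPad_cons.1 hp
    have ih := good_pad B h hg.2.2 hp'
    obtain ⟨k, hk⟩ := ih
    rw [List.flatMap_cons, List.flatMap_cons, hk]
    by_cases ha : a = []
    · subst ha
      exact ⟨B - (h x).length + k, by simp [padB]⟩
    · have := hg.2.1 ha
      exact ⟨k, by simp [padB, this]⟩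

theorem flatMap_zip {T E : Type} (B : ℕ) (g : T → List E) (hg : ∀ x, (g x).length = B)
    (w : List (T × T)) :
    (w.flatMap (fun z => (g z.1).zip (g z.2))).map Prod.fst = (w.map Prod.fst).flatMap g ∧
    (w.flatMap (fun z => (g z.1).zip (g z.2))).map Prod.snd = (w.map Prod.snd).flatMap g := by
  induction w with
  | nil => simp
  | cons z w ih =>
    have e1 : ((g z.1).zip (g z.2)).map Prod.fst = g z.1 := List.map_fst_zip (by simp [hg])
    have e2 : ((g z.1).zip (g z.2)).map Prod.snd = g z.2 := List.map_snd_zip (by simp [hg])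
    simp only [List.flatMap_cons, List.map_append, List.map_cons, e1, e2, ih, and_self]

theorem PR_decode {T E : Type} (B : ℕ) (h : T → List E) (hB : ∀ x, (h x).length ≤ B)
    {L M : Set (List T)} (hL : IsRegularSet L) (hM : IsRegularSet M)
    (gL : ∀ l ∈ L, Good B h l) (gM : ∀ l ∈ M, Good B h l)
    {R : Set (List E × List E)} (hR : IsRegularSet (PR R)) :
    IsRegularSet (PR {p : List T × List T | p.1 ∈ L ∧ p.2 ∈ M ∧
      (p.1.flatMap h, p.2.flatMap h) ∈ R}) := by
  have key := flatMap_zip B (fun x : Option T => padB B (x.elim [] h)) (by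
    intro x
    apply padB_length
    cases x <;> simp [hB])
  convert reg_inter (PR_prod hL hM) (reg_hom (fun z : Option T × Option T =>
    (padB B (z.1.elim [] h)).zip (padB B (z.2.elim [] h))) hR) using 1
  ext w
  constructor
  · rintro ⟨a, b, ⟨ha, hb, hab⟩, h1, h2⟩
    refine ⟨⟨a, b, ⟨ha, hb⟩, h1, h2⟩, ⟨_, _, hab, ?_, ?_⟩⟩
    · rw [(key w).1]
      exact good_pad B h (gL a ha) h1
    · rw [(key w).2]
      exact good_pad B h (gM b hb) h2
  · rintro ⟨⟨a, b, ⟨ha, hb⟩, h1, h2⟩, ⟨a', b', hab, h1', h2'⟩⟩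
    rw [(key w).1] at h1'
    rw [(key w).2] at h2'
    have e1 := h1'.uniq (good_pad B h (gL a ha) h1)
    have e2 := h2'.uniq (good_pad B h (gM b hb) h2)
    subst e1 e2
    exact ⟨a, b, ⟨ha, hb, hab⟩, h1, h2⟩

end Pf

namespace Pf
section paths
variable {O A E : Type} {S : Sgpd O A} (C : ChoiceOfReps S.toPreSgpd E)

def omul (S : Sgpd O A) : Option A → Option A → Option A
  | none, y => y
  | some x, none => some x
  | some x, some y => some (S.mul x y)

def val (l : List E) : Option A := evalPath? S.toPreSgpd C.lab l

def IsP (l : List E) : Prop := l.IsChain (fun e f => C.etgt e = C.esrc f)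

theorem val_nil : val C [] = none := rfl

theorem val_snoc (l : List E) (e : E) :
    val C (l ++ [e]) = omul S (val C l) (some (C.lab e)) := by
  cases l with
  | nil => rfl
  | cons x l => simp [val, evalPath?, omul]

theorem val_single (e : E) : val C [e] = some (C.lab e) := rfl

theorem val_some {l : List E} (h : l ≠ []) : ∃ a, val C l = some a := by
  cases l with
  | nil => exact absurd rfl h
  | cons x l => exact ⟨_, rfl⟩

theorem ne_of_val {l : List E} {a : A} (h : val C l = some a) : l ≠ [] := by
  rintro rfl
  simp [val_nil] at h

theorem val_src_tgt {l : List E} : ∀ {a : A}, IsP C l → val C l = some a →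
    l.head?.map C.esrc = some (S.src a) ∧ l.getLast?.map C.etgt = some (S.tgt a) := by
  induction l using List.reverseRecOn with
  | nil => intro a _ h; simp [val_nil] at h
  | append_singleton l e ih =>
    intro a hp h
    rw [val_snoc] at h
    rw [IsP, List.isChain_append] at hp
    by_cases hl : l = []
    · subst hl
      simp only [val_nil, omul, Option.some.injEq] at h
      subst h
      simp [C.lab_src, C.lab_tgt]
    · obtain ⟨b, hb⟩ := val_some C hl
      obtain ⟨h1, h2⟩ := ih hp.1 hb
      rw [hb] at h
      simp only [omul, Option.some.injEq] at h
      have hc : S.tgt b = S.src (C.lab e) := by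
        obtain ⟨x, hx, hx2⟩ := Option.map_eq_some_iff.1 h2
        rw [C.lab_src, ← hx2]
        exact hp.2.2 x hx e rfl
      subst h
      rw [S.src_mul _ _ hc, S.tgt_mul _ _ hc, C.lab_tgt]
      refine ⟨?_, by simp⟩
      rw [← h1]
      cases l with
      | nil => exact absurd rfl hl
      | cons x l => rfl

theorem isP_append {l1 l2 : List E} {a b : A} (h1 : val C l1 = some a) (h2 : val C l2 = some b) :
    IsP C (l1 ++ l2) ↔ IsP C l1 ∧ IsP C l2 ∧ S.tgt a = S.src b := by
  rw [IsP, List.isChain_append]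
  constructor
  · rintro ⟨p1, p2, h⟩
    refine ⟨p1, p2, ?_⟩
    obtain ⟨x, hx, hx2⟩ := Option.map_eq_some_iff.1 (val_src_tgt C p1 h1).2
    obtain ⟨y, hy, hy2⟩ := Option.map_eq_some_iff.1 (val_src_tgt C p2 h2).1
    rw [← hx2, ← hy2]
    exact h x hx y hy
  · rintro ⟨p1, p2, h⟩
    refine ⟨p1, p2, ?_⟩
    intro x hx y hy
    have e1 := (val_src_tgt C p1 h1).2
    have e2 := (val_src_tgt C p2 h2).1
    rw [Option.mem_def] at hx hy
    rw [hx] at e1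
    rw [hy] at e2
    simp only [Option.map_some, Option.some.injEq] at e1 e2
    rw [e1, e2, h]

theorem val_append {l1 l2 : List E} : IsP C (l1 ++ l2) →
    val C (l1 ++ l2) = omul S (val C l1) (val C l2) := by
  by_cases hl1 : l1 = []
  · subst hl1
    intro _
    rfl
  obtain ⟨a, ha⟩ := val_some C hl1
  induction l2 using List.reverseRecOn with
  | nil => intro _; simp [val_nil, ha, omul]
  | append_singleton l e ih =>
    intro hp
    rw [← List.append_assoc] at hp ⊢
    have hp' : IsP C (l1 ++ l) := List.IsChain.left_of_append hp
    rw [val_snoc, val_snoc, ih hp', ha]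
    by_cases hl : l = []
    · subst hl
      simp [val_nil, omul]
    · obtain ⟨b, hb⟩ := val_some C hl
      rw [hb]
      simp only [omul, Option.some.injEq]
      have hv : val C (l1 ++ l) = some (S.mul a b) := by
        rw [ih hp', ha, hb]
        rfl
      have c1 := ((isP_append C ha hb).1 hp').2.2
      have c2 := ((isP_append C hv (val_single C e)).1 hp).2.2
      rw [S.tgt_mul _ _ c1] at c2
      exact S.mul_assoc' _ _ _ c1 c2

theorem val_append_some {l1 l2 : List E} {a b : A} (hp : IsP C (l1 ++ l2))
    (h1 : val C l1 = some a) (h2 : val C l2 = some b) :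
    val C (l1 ++ l2) = some (S.mul a b) := by
  rw [val_append C hp, h1, h2]
  rfl

theorem K_ne {l : List E} (h : l ∈ C.K) : l ≠ [] := (C.K_path l h).1
theorem K_isP {l : List E} (h : l ∈ C.K) : IsP C l := (C.K_path l h).2

/-- right multiplication by a path -/
def relPath (l : List E) : Set (List E × List E) :=
  {p | p.1 ∈ C.K ∧ p.2 ∈ C.K ∧ IsP C (p.1 ++ l) ∧ val C (p.1 ++ l) = val C p.2}

theorem relEdge_eq (e : E) : relEdge C e = relPath C [e] := by
  ext ⟨u, v⟩
  simp only [relEdge, relPath, Set.mem_ofPred_eq]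
  refine and_congr_right fun hu => and_congr_right fun hv => and_congr_left fun _ => ?_
  obtain ⟨a, ha⟩ := val_some C (K_ne C hu)
  rw [isP_append C ha (val_single C e), pathTgt?, (val_src_tgt C (K_isP C hu) ha).2, C.lab_src]
  have : IsP C [e] := List.isChain_singleton _
  simp [K_isP C hu, this]

theorem relPath_cons (e : E) (l : List E) (hl : l ≠ []) :
    relPath C (e :: l) =
      {p : List E × List E | ∃ b, (p.1, b) ∈ relPath C [e] ∧ (b, p.2) ∈ relPath C l} := by
  ext ⟨u, v⟩
  simp only [relPath, Set.mem_ofPred_eq]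
  obtain ⟨c, hc⟩ := val_some C hl
  constructor
  · rintro ⟨hu, hv, hp, he⟩
    have hx : u ++ e :: l = (u ++ [e]) ++ l := by simp
    rw [hx] at hp he
    obtain ⟨a, ha⟩ := val_some C (l := u ++ [e]) (by simp)
    obtain ⟨b, hb, hba⟩ := C.K_onto a
    have q := (isP_append C ha hc).1 hp
    have pb : IsP C (b ++ l) := (isP_append C hba hc).2 ⟨K_isP C hb, q.2.1, q.2.2⟩
    refine ⟨b, ⟨hu, hb, q.1, ha.trans hba.symm⟩, hb, hv, pb, ?_⟩
    rw [← he, val_append_some C pb hba hc, val_append_some C hp ha hc]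
  · rintro ⟨b, ⟨hu, hb, hp, he⟩, _, hv, hp2, he2⟩
    obtain ⟨a, ha⟩ := val_some C (K_ne C hb)
    have q := (isP_append C ha hc).1 hp2
    have hp3 : IsP C ((u ++ [e]) ++ l) :=
      (isP_append C (he.trans ha) hc).2 ⟨hp, q.2.1, q.2.2⟩
    have hx : u ++ e :: l = (u ++ [e]) ++ l := by simp
    rw [hx]
    refine ⟨hu, hv, hp3, ?_⟩
    rw [← he2, val_append_some C hp3 (he.trans ha) hc, val_append_some C hp2 ha hc]

theorem PR_relPath (hC : IsAutomaticStructure C) : ∀ l : List E, l ≠ [] →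
    IsRegularSet (PR (relPath C l))
  | [], h => absurd rfl h
  | [e], _ => by
    rw [← relEdge_eq]
    exact PR_of_sync (hC.2.2.1 e)
  | e :: f :: l, _ => by
    rw [relPath_cons C e _ (by simp)]
    refine PR_comp ?_ (PR_relPath hC (f :: l) (by simp))
    rw [← relEdge_eq]
    exact PR_of_sync (hC.2.2.1 e)

variable {I Λ : Type} (R : Rees.Data0 S I Λ)

theorem sps_mul {a b : A} (h : a ∈ Rees.SPS0 S R) (hc : S.tgt a = S.src b) :
    S.mul a b ∈ Rees.SPS0 S R := by
  obtain ⟨s, p, t, lam, i, hP, h1, h2, rfl⟩ := h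
  have h3 : S.tgt (S.mul s p) = S.src t := by rw [S.tgt_mul _ _ h1, h2]
  rw [S.tgt_mul _ _ h3] at hc
  exact ⟨s, p, S.mul t b, lam, i, hP, h1, by rw [S.src_mul _ _ hc, h2],
    S.mul_assoc' _ _ _ h3 hc⟩

theorem exists_block (hK : IsRegularSet C.K) (hcof : { a : A | a ∉ Rees.SPS0 S R }.Finite) :
    ∃ B, 0 < B ∧ ∀ a, ∃ w ∈ C.K, val C w = some a ∧
      ∀ v, v <:+: w → v.length = B → ∃ b ∈ Rees.SPS0 S R, val C v = some b := by
  classical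
  obtain ⟨σ, hσ, f, hf, acc, hacc⟩ := reg_iff.1 hK
  have hfin : Finite (σ × { a : A | a ∉ Rees.SPS0 S R }) := by
    have := hcof.to_subtype
    infer_instance
  refine ⟨Nat.card (σ × { a : A | a ∉ Rees.SPS0 S R }) + 1, by omega, ?_⟩
  intro a
  have hex : ∃ n, ∃ w ∈ C.K, val C w = some a ∧ w.length = n := by
    obtain ⟨w, hw, h⟩ := C.K_onto a
    exact ⟨_, w, hw, h, rfl⟩
  obtain ⟨w, hw, hva, hlen⟩ := Nat.find_spec hex
  refine ⟨w, hw, hva, ?_⟩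
  rintro v ⟨u, z, hz⟩ hv
  set B := Nat.card (σ × { a : A | a ∉ Rees.SPS0 S R }) + 1 with hB
  have hvne : v ≠ [] := by
    rintro rfl
    simp at hv
  obtain ⟨b, hb⟩ := val_some C hvne
  refine ⟨b, ?_, hb⟩
  by_contra hbS
  have hPw : IsP C w := K_isP C hw
  have hPv : IsP C v := by
    have h0 : IsP C (u ++ v ++ z) := by rw [hz]; exact hPw
    exact (List.isChain_append.1 (List.isChain_append.1 h0).1).2.1
  -- prefixes of v
  have hpre : ∀ n : Fin B, ∃ c, val C (v.take (n + 1)) = some c ∧ c ∉ Rees.SPS0 S R := by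
    intro n
    have : v.take (n + 1) ≠ [] := by
      intro h
      simp at h
      exact hvne h
    obtain ⟨c, hc⟩ := val_some C this
    refine ⟨c, hc, fun hcS => hbS ?_⟩
    have hsplit := List.take_append_drop (n + 1) v
    by_cases hd : v.drop (n + 1) = []
    · rw [hd, List.append_nil] at hsplit
      rw [hsplit, hb] at hc
      cases hc
      exact hcS
    · obtain ⟨d, hd⟩ := val_some C hd
      rw [← hsplit] at hPv hb
      have q := ((isP_append C hc hd).1 hPv).2.2
      rw [val_append_some C hPv hc hd] at hb
      cases hb
      exact sps_mul R hcS q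
  choose c hc hcS using hpre
  obtain ⟨m, n, hmn, he⟩ : ∃ m n : Fin B, m ≠ n ∧
      (f (u ++ v.take (m + 1)), (⟨c m, hcS m⟩ : { a : A | a ∉ Rees.SPS0 S R })) =
      (f (u ++ v.take (n + 1)), (⟨c n, hcS n⟩ : { a : A | a ∉ Rees.SPS0 S R })) := by
    have hni : ¬ Function.Injective (fun m : Fin B => (f (u ++ v.take (m + 1)),
        (⟨c m, hcS m⟩ : { a : A | a ∉ Rees.SPS0 S R }))) := by
      intro hi
      have : Nat.card (Fin B) ≤ Nat.card (σ × { a : A | a ∉ Rees.SPS0 S R }) :=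
        Nat.card_le_card_of_injective _ hi
      rw [Nat.card_fin] at this
      omega
    simp only [Function.Injective] at hni
    push Not at hni
    obtain ⟨m, n, h1, h2⟩ := hni
    exact ⟨m, n, h2, h1⟩
  wlog hlt : m < n generalizing m n
  · exact this n m hmn.symm he.symm (lt_of_le_of_ne (not_lt.1 hlt) hmn.symm)
  simp only [Prod.mk.injEq, Subtype.mk.injEq] at he
  obtain ⟨he1, he2⟩ := he
  have hwn : w = u ++ v.take (n + 1) ++ (v.drop (n + 1) ++ z) := by
    rw [← hz]
    conv_lhs => rw [← List.take_append_drop (n + 1) v]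
    simp only [List.append_assoc]
  set rest := v.drop (n + 1) ++ z with hrest
  have hw2 : u ++ v.take (m + 1) ++ rest ∈ C.K := by
    rw [hacc] at hw ⊢
    rw [key_append hf _ _ _ he1, ← hwn]
    exact hw
  have hP2 := K_isP C hw2
  have hv2 : val C (u ++ v.take (m + 1) ++ rest) = some a := by
    rw [← hva, hwn, val_append C hP2, val_append C (List.IsChain.left_of_append hP2)]
    rw [hwn] at hPw
    rw [val_append C hPw, val_append C (List.IsChain.left_of_append hPw), hc, hc, he2]
  have hshort : (u ++ v.take (m + 1) ++ rest).length < w.length := by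
    have hm := m.2
    have hn := n.2
    have hlt' : (m : ℕ) < n := hlt
    rw [hwn]
    simp only [List.length_append, List.length_take]
    omega
  rw [hlen] at hshort
  exact Nat.find_min hex hshort ⟨_, hw2, hv2, rfl⟩

end paths
end Pf

namespace Pf
section rees
variable {O A E I Λ : Type} {S : Sgpd O A}

theorem trip_inj {R : Rees.Data0 S I Λ} {t t' : I × A × Λ} {h : Rees.Valid S R.F R.G t}
    {h' : Rees.Valid S R.F R.G t'} (e : (some ⟨t, h⟩ : Rees.Carrier0 S R) = some ⟨t', h'⟩) :
    t = t' := by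
  have := Option.some.inj e
  exact congrArg Subtype.val this

theorem trip_ne {R : Rees.Data0 S I Λ} {t : I × A × Λ} {h : Rees.Valid S R.F R.G t}
    (e : (some ⟨t, h⟩ : Rees.Carrier0 S R) = none) : False := by
  cases e

def Rep {R : Rees.Data0 S I Λ} (m : Rees.Carrier0 S R) (i : I) (x : A) (mu : Λ) : Prop :=
  ∃ h : Rees.Valid S R.F R.G (i, x, mu), m = some ⟨(i, x, mu), h⟩

theorem Rep.inj {R : Rees.Data0 S I Λ} {m : Rees.Carrier0 S R} {i j : I} {x y : A} {mu nu : Λ}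
    (h1 : Rep m i x mu) (h2 : Rep m j y nu) : i = j ∧ x = y ∧ mu = nu := by
  obtain ⟨h, rfl⟩ := h1
  obtain ⟨h', e⟩ := h2
  have := trip_inj e
  simpa using this

theorem Rep.ne {R : Rees.Data0 S I Λ} {m : Rees.Carrier0 S R} {i : I} {x : A} {mu : Λ}
    (h1 : Rep m i x mu) : m ≠ none := by
  obtain ⟨h, rfl⟩ := h1
  exact fun e => trip_ne e

theorem mul0_aux0 {R : Rees.Data0 S I Λ} {i j : I} {x y : A} {mu nu : Λ}
    (h1 : Rees.Valid S R.F R.G (i, x, mu)) (h2 : Rees.Valid S R.F R.G (j, y, nu)) :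
    Rees.mul0 S R (some ⟨(i, x, mu), h1⟩) (some ⟨(j, y, nu), h2⟩) =
      (match hp : R.P mu j with
      | some p => (some ⟨(i, S.mul (S.mul x p) y, nu),
          Rees.prod_valid S h1 h2 (R.P_src mu j p hp) (R.P_tgt mu j p hp)⟩ : Rees.Carrier0 S R)
      | none => none) := rfl

theorem mul0_aux {R : Rees.Data0 S I Λ} {i j : I} {x y : A} {mu nu : Λ}
    (h1 : Rees.Valid S R.F R.G (i, x, mu)) (h2 : Rees.Valid S R.F R.G (j, y, nu))
    (o : Option A) (ho : R.P mu j = o) :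
    Rees.mul0 S R (some ⟨(i, x, mu), h1⟩) (some ⟨(j, y, nu), h2⟩) =
      (match (motive := (o : Option A) → R.P mu j = o → Rees.Carrier0 S R) o, ho with
      | some p, hp => some ⟨(i, S.mul (S.mul x p) y, nu),
          Rees.prod_valid S h1 h2 (R.P_src mu j p hp) (R.P_tgt mu j p hp)⟩
      | none, _ => none) := by
  refine (mul0_aux0 h1 h2).trans ?_
  split
  · rename_i p hp
    have : o = some p := by rw [← ho, hp]
    subst this
    rfl
  · rename_i hp
    have : o = none := by rw [← ho, hp]
    subst this
    rfl

theorem rep_mul {R : Rees.Data0 S I Λ} {m n : Rees.Carrier0 S R} {i j : I} {x y p : A} {mu nu : Λ}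
    (h1 : Rep m i x mu) (h2 : Rep n j y nu) (hp : R.P mu j = some p) :
    Rep (Rees.mul0 S R m n) i (S.mul (S.mul x p) y) nu := by
  obtain ⟨h1, rfl⟩ := h1
  obtain ⟨h2, rfl⟩ := h2
  exact ⟨Rees.prod_valid S h1 h2 (R.P_src _ _ _ hp) (R.P_tgt _ _ _ hp), mul0_aux h1 h2 _ hp⟩

theorem rep_mul_zero {R : Rees.Data0 S I Λ} {m n : Rees.Carrier0 S R} {i j : I} {x y : A}
    {mu nu : Λ} (h1 : Rep m i x mu) (h2 : Rep n j y nu) (hp : R.P mu j = none) :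
    Rees.mul0 S R m n = none := by
  obtain ⟨h1, rfl⟩ := h1
  obtain ⟨h2, rfl⟩ := h2
  exact mul0_aux h1 h2 _ hp

theorem mul0_none {R : Rees.Data0 S I Λ} (m : Rees.Carrier0 S R) :
    Rees.mul0 S R m none = none := by
  rcases m with _ | ⟨⟨i, x, mu⟩, h⟩ <;> rfl

theorem none_mul0 {R : Rees.Data0 S I Λ} (m : Rees.Carrier0 S R) :
    Rees.mul0 S R none m = none := by
  rcases m with _ | ⟨⟨i, x, mu⟩, h⟩ <;> rfl

variable (C : ChoiceOfReps S.toPreSgpd E) (R : Rees.Data0 S I Λ) (B : ℕ)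

def Blk : Type := {b : List E // b.length = B ∧ ∃ a ∈ Rees.SPS0 S R, val C b = some a}

def Short (E : Type) (B : ℕ) : Type := {r : List E // r.length ≤ B}

abbrev Tok : Type := (I ⊕ Blk C R B) × (Blk C R B ⊕ (Short E B × Λ))

instance [Finite E] : Finite (Blk C R B) :=
  Set.Finite.to_subtype (s := {b : List E | b.length = B ∧ ∃ a ∈ Rees.SPS0 S R, val C b = some a})
    ((List.finite_length_eq E B).subset (fun _ h => h.1))

instance [Finite E] : Finite (Short E B) := (List.finite_length_le E B).to_subtype

structure BDec (b : List E) where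
  s : A
  p : A
  t : A
  lam : Λ
  i : I
  hP : R.P lam i = some p
  h1 : S.tgt s = S.src p
  h2 : S.tgt p = S.src t
  hv : val C b = some (S.mul (S.mul s p) t)

noncomputable def bdec (b : Blk C R B) : BDec C R b.1 := by
  refine Classical.choice ?_
  obtain ⟨a, ⟨s, p, t, lam, i, hP, h1, h2, rfl⟩, hv⟩ := b.2.2
  exact ⟨⟨s, p, t, lam, i, hP, h1, h2, hv⟩⟩

variable {C R B}

def piece (t : Tok C R B) : List E := t.2.elim (fun c => c.1) (fun r => r.1.1)

noncomputable def st (t : Tok C R B) : I := t.1.elim id (fun b => (bdec C R B b).i)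
noncomputable def en (t : Tok C R B) : Λ := t.2.elim (fun b => (bdec C R B b).lam) (fun r => r.2)
noncomputable def curv (t : Tok C R B) : Option A :=
  t.2.elim (fun b => some (bdec C R B b).s) (fun r => val C r.1.1)
noncomputable def prv (t : Tok C R B) : Option A :=
  t.1.elim (fun _ => none) (fun b => some (bdec C R B b).t)
noncomputable def tv (t : Tok C R B) : Option A :=
  (curv t).elim none (fun y => omul S (prv t) (some y))

def mkT (R : Rees.Data0 S I Λ) (t : I × A × Λ) (h : Rees.Valid S R.F R.G t) :
    Rees.Carrier0 S R := some ⟨t, h⟩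

def zeroT (R : Rees.Data0 S I Λ) : Rees.Carrier0 S R := none

open Classical in
noncomputable def tlab (t : Tok C R B) : Rees.Carrier0 S R :=
  if h : ∃ x, tv t = some x ∧ Rees.Valid S R.F R.G (st t, x, en t)
  then mkT R (st t, h.choose, en t) h.choose_spec.2 else zeroT R

theorem tlab_rep {t : Tok C R B} {x : A} (h : tv t = some x)
    (hv : Rees.Valid S R.F R.G (st t, x, en t)) : Rep (tlab t) (st t) x (en t) := by
  have hex : ∃ x, tv t = some x ∧ Rees.Valid S R.F R.G (st t, x, en t) := ⟨x, h, hv⟩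
  have hx : hex.choose = x := Option.some.inj (hex.choose_spec.1.symm.trans h)
  have e : tlab t = mkT R (st t, hex.choose, en t) hex.choose_spec.2 := dif_pos hex
  rw [e]
  have : ∀ y (hy : y = x) (hv' : Rees.Valid S R.F R.G (st t, y, en t)),
      Rep (mkT R (st t, y, en t) hv') (st t) x (en t) := by
    rintro y rfl hv'
    exact ⟨hv', rfl⟩
  exact this _ hx _

theorem tlab_zero {t : Tok C R B} (h : curv t = none) : tlab t = none := by
  refine dif_neg ?_
  rintro ⟨x, hx, -⟩
  simp [tv, h] at hx

def link (t t' : Tok C R B) : Prop := ∃ c, t.2 = Sum.inl c ∧ t'.1 = Sum.inr c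

noncomputable def Mev (w : List (Tok C R B)) : Option (Rees.Carrier0 S R) :=
  evalPath? (Rees.pre0 S R) tlab w

theorem Mev_snoc {w : List (Tok C R B)} {m : Rees.Carrier0 S R} (h : Mev w = some m)
    (t : Tok C R B) : Mev (w ++ [t]) = some (Rees.mul0 S R m (tlab t)) := by
  cases w with
  | nil => simp [Mev, evalPath?] at h
  | cons x w =>
    simp only [Mev, evalPath?, Option.some.injEq] at h
    simp only [Mev, evalPath?, List.cons_append, List.map_append, List.map_cons, List.map_nil,
      List.foldl_append, h, List.foldl_cons, List.foldl_nil]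
    rfl

theorem Mev_single (t : Tok C R B) : Mev [t] = some (tlab t) := rfl

theorem mev_main (hB : 0 < B) (i : I) (w : List (Tok C R B)) : w.IsChain link →
    w.head?.map Prod.fst = some (Sum.inl i) → ∀ a, IsP C (w.flatMap piece) →
    val C (w.flatMap piece) = some a → R.F i = S.src a →
    (∀ c, w.getLast?.map Prod.snd = some (Sum.inl c) → ∃ x m, Mev w = some m ∧
      Rep m i x (bdec C R B c).lam ∧ S.mul (S.mul x (bdec C R B c).p) (bdec C R B c).t = a) ∧
    (∀ r mu, w.getLast?.map Prod.snd = some (Sum.inr (r, mu)) → r.1 ≠ [] → S.tgt a = R.G mu →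
      ∃ m, Mev w = some m ∧ Rep m i a mu) := by
  induction w using List.reverseRecOn with
  | nil => intro _ h; simp at h
  | append_singleton w t ih =>
    intro hch hhd a hp hv hF
    rcases List.eq_nil_or_concat w with rfl | ⟨w1, t0, rfl⟩
    · -- single token
      obtain ⟨t1, t2⟩ := t
      simp only [List.nil_append, List.head?_cons, Option.map_some, Option.some.injEq] at hhd
      subst hhd
      simp only [List.nil_append, List.flatMap_cons, List.flatMap_nil, List.append_nil] at hv hp
      constructor
      · intro c hc
        simp only [List.nil_append, List.getLast?_singleton, Option.map_some,
          Option.some.injEq] at hc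
        subst hc
        have d := bdec C R B c
        set d := bdec C R B c with hd
        have e : S.mul (S.mul d.s d.p) d.t = a := by
          have := d.hv
          simp only [piece, Sum.elim_inl] at hv
          rw [hv] at this
          exact (Option.some.inj this).symm
        refine ⟨d.s, _, Mev_single _, tlab_rep (x := d.s) rfl ?_, e⟩
        have := d.h1
        have := d.h2
        have := R.P_src _ _ _ d.hP
        constructor
        · show R.F i = S.src d.s
          grind [S.src_mul, S.tgt_mul]
        · show S.tgt d.s = R.G d.lam
          grind
      · intro r mu hr hne hG
        simp only [List.nil_append, List.getLast?_singleton, Option.map_some,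
          Option.some.injEq] at hr
        subst hr
        refine ⟨_, Mev_single _, tlab_rep (x := a) ?_ ⟨hF, hG⟩⟩
        have : val C r.1 = some a := hv
        simp [tv, curv, prv, this, omul]
    · rw [List.concat_eq_append] at *
      rw [List.isChain_append] at hch
      obtain ⟨hch1, -, hl⟩ := hch
      obtain ⟨c, hc1, hc2⟩ := hl t0 (by simp) t (by simp)
      obtain ⟨t1, t2⟩ := t
      obtain ⟨t01, t02⟩ := t0
      simp only at hc1 hc2
      subst hc1 hc2
      have hhd' : (w1 ++ [(t01, Sum.inl c)]).head?.map Prod.fst = some (Sum.inl i) := by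
        rw [← hhd]
        cases w1 <;> simp
      set d := bdec C R B c with hd
      set w0 := w1 ++ [((t01, Sum.inl c) : Tok C R B)] with hw0
      have hne0 : w0.flatMap piece ≠ [] := by
        rw [hw0]
        intro h
        simp only [List.flatMap_append, List.append_eq_nil_iff] at h
        have h2 := h.2
        simp only [List.flatMap_cons, List.flatMap_nil, List.append_nil, piece, Sum.elim_inl] at h2
        have := c.2.1
        rw [h2] at this
        simp at this
        omega
      obtain ⟨a0, ha0⟩ := val_some C hne0
      rw [List.flatMap_append] at hp hv
      simp only [List.flatMap_cons, List.flatMap_nil, List.append_nil] at hp hv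
      have step : ∀ b, val C (piece ((Sum.inr c, t2) : Tok C R B)) = some b →
          S.tgt a0 = S.src b ∧ a = S.mul a0 b ∧ ∃ x m, Mev w0 = some m ∧
          Rep m i x d.lam ∧ S.mul (S.mul x d.p) d.t = a0 := by
        intro b hb
        have q := (isP_append C ha0 hb).1 hp
        have e := val_append_some C hp ha0 hb
        rw [hv] at e
        have e' := Option.some.inj e
        refine ⟨q.2.2, e', ?_⟩
        refine (ih hch1 hhd' a0 q.1 ha0 ?_).1 c (by simp [hw0])
        rw [hF, e', S.src_mul _ _ q.2.2]
      have Ph := d.hP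
      have P1 := d.h1
      have P2 := d.h2
      have P3 := R.P_src _ _ _ d.hP
      have P4 := R.P_tgt _ _ _ d.hP
      constructor
      · intro c' hc'
        simp only [List.getLast?_append, List.getLast?_singleton, Option.some_or, Option.map_some,
          Option.some.injEq] at hc'
        subst hc'
        set d' := bdec C R B c' with hd'
        obtain ⟨hab, rfl, x, m, hm, hrep, rfl⟩ := step _ d'.hv
        have Q1 := d'.h1
        have Q2 := d'.h2
        have Q3 := R.P_src _ _ _ d'.hP
        have hxv : S.tgt x = S.src d.p := by
          obtain ⟨hx, -⟩ := hrep
          rw [P3]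
          exact hx.2
        have k1 : S.tgt (S.mul x d.p) = S.src d.t := by rw [S.tgt_mul _ _ hxv, P2]
        have k2 : S.tgt (S.mul d'.s d'.p) = S.src d'.t := by rw [S.tgt_mul _ _ Q1, Q2]
        have k3 : S.tgt d.t = S.src d'.s := by
          rw [S.tgt_mul _ _ k1, S.src_mul _ _ k2, S.src_mul _ _ Q1] at hab
          exact hab
        refine ⟨_, _, Mev_snoc hm _, rep_mul hrep (tlab_rep (x := S.mul d.t d'.s) rfl ?_) Ph, ?_⟩
        · constructor
          · show R.F d.i = S.src (S.mul d.t d'.s)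
            rw [S.src_mul _ _ k3, ← P2, P4]
          · show S.tgt (S.mul d.t d'.s) = R.G d'.lam
            rw [S.tgt_mul _ _ k3, Q1, Q3]
        · show S.mul (S.mul (S.mul (S.mul x d.p) (S.mul d.t d'.s)) d'.p) d'.t = _
          generalize S.mul x d.p = y at *
          have k4 : S.tgt (S.mul d.t d'.s) = S.src d'.p := by rw [S.tgt_mul _ _ k3, Q1]
          have k5 : S.tgt y = S.src (S.mul d.t d'.s) := by rw [S.src_mul _ _ k3, k1]
          have k6 : S.tgt (S.mul y d.t) = S.src d'.s := by rw [S.tgt_mul _ _ k1, k3]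
          rw [← S.mul_assoc' y d.t d'.s k1 k3, S.mul_assoc' (S.mul y d.t) d'.s d'.p k6 Q1,
            S.mul_assoc' (S.mul y d.t) (S.mul d'.s d'.p) d'.t (by rw [S.src_mul _ _ Q1, k6]) k2]
      · intro r mu hr hne hG
        simp only [List.getLast?_append, List.getLast?_singleton, Option.some_or, Option.map_some,
          Option.some.injEq] at hr
        subst hr
        obtain ⟨b, hb⟩ := val_some C hne
        obtain ⟨hab, rfl, x, m, hm, hrep, rfl⟩ := step b hb
        have hxv : S.tgt x = S.src d.p := by
          obtain ⟨hx, -⟩ := hrep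
          rw [P3]
          exact hx.2
        have k1 : S.tgt (S.mul x d.p) = S.src d.t := by rw [S.tgt_mul _ _ hxv, P2]
        have k3 : S.tgt d.t = S.src b := by
          rw [S.tgt_mul _ _ k1] at hab
          exact hab
        refine ⟨_, Mev_snoc hm _, ?_⟩
        rw [S.mul_assoc' _ _ _ k1 k3]
        refine rep_mul hrep (tlab_rep (x := S.mul d.t b) ?_ ?_) Ph
        · simp only [tv, curv, prv, Sum.elim_inr, hb, Option.elim_some, omul]
          rfl
        · constructor
          · show R.F d.i = S.src (S.mul d.t b)
            rw [S.src_mul _ _ k3, ← P2, P4]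
          · show S.tgt (S.mul d.t b) = R.G mu
            rw [S.tgt_mul _ _ hab] at hG
            rw [S.tgt_mul _ _ k3, hG]

end rees
end Pf

namespace Pf
section fin
variable {O A E I Λ : Type} {S : Sgpd O A} {C : ChoiceOfReps S.toPreSgpd E}
  {R : Rees.Data0 S I Λ} {B : ℕ}

theorem piece_le (t : Tok C R B) : (piece t).length ≤ B := by
  obtain ⟨t1, c | r⟩ := t
  · exact c.2.1.le
  · exact r.1.2

theorem good_of_chain (w : List (Tok C R B)) (h : w.IsChain link) : Good B piece w := by
  induction w with
  | nil => trivial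
  | cons t w ih =>
    refine ⟨piece_le t, ?_, ih h.tail⟩
    intro hw
    cases w with
    | nil => exact absurd rfl hw
    | cons t' w =>
      rw [List.isChain_cons_cons] at h
      obtain ⟨c, hc, -⟩ := h.1
      simp only [piece, hc, Sum.elim_inl]
      exact c.2.1

/-- Token words representing non-zero elements. -/
def KK (C : ChoiceOfReps S.toPreSgpd E) (R : Rees.Data0 S I Λ) (B : ℕ) (i : I) (mu : Λ) :
    Set (List (Tok C R B)) :=
  ({w | w.IsChain link} ∩ {w | w.head?.map Prod.fst = some (Sum.inl i) ∧
    ∃ r, w.getLast?.map Prod.snd = some (Sum.inr (r, mu)) ∧ r.1 ≠ []}) ∩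
  {w | w.flatMap piece ∈ C.K ∩ {l | l.head?.map C.esrc = some (R.F i) ∧
    l.getLast?.map C.etgt = some (R.G mu)}}

theorem KK_reg [Finite E] [Finite I] [Finite Λ] (hK : IsRegularSet C.K) (i : I) (mu : Λ) :
    IsRegularSet (KK C R B i mu) := by
  refine reg_inter (reg_inter (reg_chain _) ?_) (reg_hom _ (reg_inter hK ?_))
  · exact reg_ends (α := Tok C R B) (fun x y => x.map Prod.fst = some (Sum.inl i) ∧
      ∃ r : Short E B, y.map Prod.snd = some (Sum.inr (r, mu)) ∧ r.1 ≠ [])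
  · exact reg_ends (fun x y => x.map C.esrc = some (R.F i) ∧ y.map C.etgt = some (R.G mu))

theorem KK_val (hB : 0 < B) {i : I} {mu : Λ} {w : List (Tok C R B)} (hw : w ∈ KK C R B i mu) :
    ∃ m a, Mev w = some m ∧ val C (w.flatMap piece) = some a ∧ Rep m i a mu := by
  obtain ⟨⟨h1, h2, r, h3, h4⟩, h5, h6, h7⟩ := hw
  obtain ⟨a, ha⟩ := val_some C (K_ne C h5)
  have hp := K_isP C h5
  have q := val_src_tgt C hp ha
  rw [h6, h7] at q
  obtain ⟨m, hm, hr⟩ := (mev_main hB i w h1 h2 a hp ha (Option.some.inj q.1)).2 r mu h3 h4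
    (Option.some.inj q.2).symm
  exact ⟨m, a, hm, ha, hr⟩

def zt (C : ChoiceOfReps S.toPreSgpd E) (R : Rees.Data0 S I Λ) (B : ℕ) (i : I) (mu : Λ) :
    Tok C R B := (Sum.inl i, Sum.inr (⟨[], Nat.zero_le _⟩, mu))

theorem zt_lab (i : I) (mu : Λ) : tlab (zt C R B i mu) = zeroT R := tlab_zero rfl

def KX (C : ChoiceOfReps S.toPreSgpd E) (R : Rees.Data0 S I Λ) (B : ℕ) (z : Tok C R B) :
    Option (I × Λ) → Set (List (Tok C R B))
  | none => {w | w = [z]}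
  | some q => KK C R B q.1 q.2

theorem KX_reg [Finite E] [Finite I] [Finite Λ] (hK : IsRegularSet C.K) (z : Tok C R B)
    (c : Option (I × Λ)) : IsRegularSet (KX C R B z c) := by
  cases c with
  | none => exact reg_singleton z
  | some q => exact KK_reg hK _ _

theorem KX_ne {z : Tok C R B} {c : Option (I × Λ)} {w : List (Tok C R B)}
    (h : w ∈ KX C R B z c) : w ≠ [] := by
  cases c with
  | none =>
    have : w = [z] := h
    simp [this]
  | some q =>
    rintro rfl
    have := h.1.2.1
    simp at this

theorem build (mu : Λ) (n : ℕ) : ∀ w : List E, w.length ≤ n → w ≠ [] →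
    (∀ v, v <:+: w → v.length = B → ∃ b ∈ Rees.SPS0 S R, val C v = some b) → 0 < B →
    ∀ pr : I ⊕ Blk C R B, ∃ w' : List (Tok C R B), w'.IsChain link ∧
      w'.head?.map Prod.fst = some pr ∧
      (∃ r, w'.getLast?.map Prod.snd = some (Sum.inr (r, mu)) ∧ r.1 ≠ []) ∧
      w'.flatMap piece = w := by
  induction n with
  | zero =>
    intro w h1 h2
    exact absurd (List.eq_nil_of_length_eq_zero (by omega)) h2
  | succ n ih =>
    intro w h1 h2 h3 hB pr
    by_cases hl : w.length ≤ B
    · refine ⟨[(pr, Sum.inr (⟨w, hl⟩, mu))], by simp, rfl, ⟨⟨w, hl⟩, rfl, h2⟩, ?_⟩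
      simp [piece]
    · have hlen : (w.take B).length = B := by simp; omega
      let c : Blk C R B := ⟨w.take B, hlen, h3 _ ⟨[], w.drop B, List.take_append_drop B w⟩ hlen⟩
      obtain ⟨w', k1, k2, ⟨r, k3, k4⟩, k5⟩ := ih (w.drop B) (by simp; omega)
        (by intro h; have := congrArg List.length h; simp at this; omega)
        (fun v hv => h3 v (hv.trans (List.drop_suffix B w).isInfix)) hB (Sum.inr c)
      cases w' with
      | nil => simp at k2
      | cons t w' =>
        simp only [List.head?_cons, Option.map_some, Option.some.injEq] at k2
        refine ⟨(pr, Sum.inl c) :: t :: w', ?_, rfl, ⟨r, ?_, k4⟩, ?_⟩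
        · rw [List.isChain_cons_cons]
          exact ⟨⟨c, rfl, k2⟩, k1⟩
        · rw [List.getLast?_cons_cons]
          exact k3
        · rw [List.flatMap_cons, k5]
          exact List.take_append_drop B w

theorem KX_onto (hB : 0 < B)
    (hblk : ∀ a, ∃ w ∈ C.K, val C w = some a ∧
      ∀ v, v <:+: w → v.length = B → ∃ b ∈ Rees.SPS0 S R, val C v = some b)
    (z : Tok C R B) (hz : tlab z = zeroT R) (m : Rees.Carrier0 S R) :
    ∃ c, ∃ w ∈ KX C R B z c, Mev w = some m := by
  rcases m with _ | ⟨⟨i, a, mu⟩, hv⟩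
  · exact ⟨none, [z], rfl, congrArg some hz⟩
  · obtain ⟨w, hK, hw, hb⟩ := hblk a
    obtain ⟨w', k1, k2, k3, k5⟩ := build (C := C) (R := R) (B := B) mu w.length w le_rfl
      (K_ne C hK) hb hB (Sum.inl i)
    have q := val_src_tgt C (K_isP C hK) hw
    have hmem : w' ∈ KK C R B i mu := by
      refine ⟨⟨k1, k2, k3⟩, ?_⟩
      rw [Set.mem_ofPred_eq, k5]
      refine ⟨hK, ?_, ?_⟩
      · rw [q.1]
        exact congrArg some hv.1.symm
      · rw [q.2]
        exact congrArg some hv.2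
    refine ⟨some (i, mu), w', hmem, ?_⟩
    obtain ⟨m, a', hm, ha', hr⟩ := KK_val hB hmem
    rw [k5, hw] at ha'
    cases ha'
    obtain ⟨h, rfl⟩ := hr
    exact hm

/-- The choice of representatives for the Rees matrix semigroup. -/
noncomputable def CC (hB : 0 < B)
    (hblk : ∀ a, ∃ w ∈ C.K, val C w = some a ∧
      ∀ v, v <:+: w → v.length = B → ∃ b ∈ Rees.SPS0 S R, val C v = some b)
    (z : Tok C R B) (hz : tlab z = zeroT R) : ChoiceOfReps (Rees.pre0 S R) (Tok C R B) where
  esrc _ := ()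
  etgt _ := ()
  lab := tlab
  lab_src _ := rfl
  lab_tgt _ := rfl
  K := ⋃ c, KX C R B z c
  K_path := by
    intro l hl
    obtain ⟨c, hc⟩ := Set.mem_iUnion.1 hl
    refine ⟨KX_ne hc, ?_⟩
    show List.IsChain _ l
    rw [List.isChain_iff_getElem]
    intros
    rfl
  K_onto := by
    intro m
    obtain ⟨c, w, hw, h⟩ := KX_onto hB hblk z hz m
    exact ⟨w, Set.mem_iUnion.2 ⟨c, hw⟩, h⟩

theorem sync_pieces [Finite E] [Finite I] [Finite Λ] {z : Tok C R B}
    {T : List (Tok C R B) → List (Tok C R B) → Prop} {t : Tok C R B → Unit}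
    {Q : Set (List (Tok C R B) × List (Tok C R B))}
    (hQ : ∀ u v, (u, v) ∈ Q ↔ u ∈ (⋃ c, KX C R B z c) ∧ v ∈ (⋃ c, KX C R B z c) ∧ T u v)
    (h : ∀ c d, IsRegularSet (PR {p | p.1 ∈ KX C R B z c ∧ p.2 ∈ KX C R B z d ∧ T p.1 p.2})) :
    SyncRegular t Q := by
  refine sync_of_PR ?_ (PR_mono_eq ?_ (PR_iUnion (ι := Option (I × Λ) × Option (I × Λ))
    (fun q => h q.1 q.2)))
  · rintro ⟨u, v⟩ hp
    obtain ⟨h1, h2, -⟩ := (hQ u v).1 hp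
    obtain ⟨c, hc⟩ := Set.mem_iUnion.1 h1
    obtain ⟨d, hd⟩ := Set.mem_iUnion.1 h2
    exact ⟨KX_ne hc, KX_ne hd⟩
  · ext ⟨u, v⟩
    rw [hQ, Set.mem_iUnion, Set.mem_iUnion, Set.mem_iUnion]
    constructor
    · rintro ⟨⟨c, d⟩, h1, h2, h3⟩
      exact ⟨⟨c, h1⟩, ⟨d, h2⟩, h3⟩
    · rintro ⟨⟨c, h1⟩, ⟨d, h2⟩, h3⟩
      exact ⟨(c, d), h1, h2, h3⟩

section pieces
variable [Finite E] [Finite I] [Finite Λ] {z : Tok C R B}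
  {T : List (Tok C R B) → List (Tok C R B) → Prop} {c d : Option (I × Λ)}

theorem piece_full (hK : IsRegularSet C.K)
    (h : ∀ u ∈ KX C R B z c, ∀ v ∈ KX C R B z d, T u v) :
    IsRegularSet (PR {p | p.1 ∈ KX C R B z c ∧ p.2 ∈ KX C R B z d ∧ T p.1 p.2}) := by
  refine PR_mono_eq ?_ (PR_prod (KX_reg hK z c) (KX_reg hK z d))
  ext ⟨u, v⟩
  exact ⟨fun q => ⟨q.1, q.2, h _ q.1 _ q.2⟩, fun q => ⟨q.1, q.2.1⟩⟩

theorem piece_empty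
    (h : ∀ u ∈ KX C R B z c, ∀ v ∈ KX C R B z d, ¬ T u v) :
    IsRegularSet (PR {p | p.1 ∈ KX C R B z c ∧ p.2 ∈ KX C R B z d ∧ T p.1 p.2}) := by
  convert reg_empty
  ext w
  constructor
  · rintro ⟨a, b, ⟨h1, h2, h3⟩, -⟩
    exact h _ h1 _ h2 h3
  · rintro ⟨⟩

theorem piece_dec (hK : IsRegularSet C.K) {i j : I} {mu nu : Λ} {Q : Set (List E × List E)}
    (hQ : IsRegularSet (PR Q))
    (h : ∀ u ∈ KK C R B i mu, ∀ v ∈ KK C R B j nu,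
      (T u v ↔ (u.flatMap piece, v.flatMap piece) ∈ Q)) :
    IsRegularSet (PR {p | p.1 ∈ KX C R B z (some (i, mu)) ∧ p.2 ∈ KX C R B z (some (j, nu)) ∧
      T p.1 p.2}) := by
  refine PR_mono_eq ?_ (PR_decode B piece piece_le (KK_reg (B := B) (R := R) hK i mu)
    (KK_reg (B := B) (R := R) hK j nu) (fun l hl => good_of_chain l hl.1.1)
    (fun l hl => good_of_chain l hl.1.1) hQ)
  ext ⟨u, v⟩
  exact ⟨fun q => ⟨q.1, q.2.1, (h _ q.1 _ q.2.1).2 q.2.2⟩,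
    fun q => ⟨q.1, q.2.1, (h _ q.1 _ q.2.1).1 q.2.2⟩⟩

end pieces

theorem rep_ne {m : Rees.Carrier0 S R} {i : I} {a : A} {mu : Λ} (h : Rep m i a mu) :
    m ≠ zeroT R := h.ne

theorem rep_eq {m n : Rees.Carrier0 S R} {i : I} {a : A} {mu : Λ} (h : Rep m i a mu)
    (h' : Rep n i a mu) : m = n := by
  obtain ⟨_, rfl⟩ := h
  obtain ⟨_, rfl⟩ := h'
  rfl

theorem mem_none {z : Tok C R B} (hz : tlab z = zeroT R) {w : List (Tok C R B)}
    (h : w ∈ KX C R B z none) : Mev w = some (zeroT R) := by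
  have : w = [z] := h
  subst this
  exact congrArg some hz

/-- Pieces for a function with non-zero, decodable values on the first component. -/
theorem piece_rep [Finite E] [Finite I] [Finite Λ] (hC : IsAutomaticStructure C) (hB : 0 < B)
    {z : Tok C R B} (hz : tlab z = zeroT R) {f : List (Tok C R B) → Option (Rees.Carrier0 S R)}
    {i i' : I} {mu mu' : Λ} (Q : Set (List E × List E)) (hQ : IsRegularSet (PR Q))
    (hf : ∀ u ∈ KK C R B i mu, ∃ m b, f u = some m ∧ Rep m i' b mu' ∧
      ∀ v ∈ C.K, ((u.flatMap piece, v) ∈ Q ↔ some b = val C v)) (d : Option (I × Λ)) :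
    IsRegularSet (PR {p | p.1 ∈ KX C R B z (some (i, mu)) ∧ p.2 ∈ KX C R B z d ∧
      f p.1 = Mev p.2}) := by
  cases d with
  | none =>
    refine piece_empty (T := fun u v => f u = Mev v) ?_
    intro u hu v hv h
    obtain ⟨m, b, h1, h2, -⟩ := hf u hu
    rw [h1, mem_none hz hv] at h
    exact rep_ne h2 (Option.some.inj h)
  | some q =>
    obtain ⟨j, nu⟩ := q
    by_cases hq : i' = j ∧ mu' = nu
    · obtain ⟨rfl, rfl⟩ := hq
      refine piece_dec (T := fun u v => f u = Mev v) hC.2.1 hQ ?_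
      intro u hu v hv
      obtain ⟨m, b, h1, h2, h3⟩ := hf u hu
      obtain ⟨n, a, g1, g2, g3⟩ := KK_val hB hv
      rw [h3 _ hv.2.1, h1, g1, g2]
      constructor
      · intro h
        have := Option.some.inj h
        subst this
        rw [(h2.inj g3).2.1]
      · intro h
        have := Option.some.inj h
        subst this
        rw [rep_eq h2 g3]
    · refine piece_empty (T := fun u v => f u = Mev v) ?_
      intro u hu v hv h
      obtain ⟨m, b, h1, h2, -⟩ := hf u hu
      obtain ⟨n, a, g1, g2, g3⟩ := KK_val hB hv
      rw [h1, g1] at h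
      have := Option.some.inj h
      subst this
      exact hq ⟨(h2.inj g3).1, (h2.inj g3).2.2⟩

theorem piece_zero [Finite E] [Finite I] [Finite Λ] (hC : IsAutomaticStructure C) (hB : 0 < B)
    {z : Tok C R B} (hz : tlab z = zeroT R) {f : List (Tok C R B) → Option (Rees.Carrier0 S R)}
    {c : Option (I × Λ)} (hf : ∀ u ∈ KX C R B z c, f u = some (zeroT R)) (d : Option (I × Λ)) :
    IsRegularSet (PR {p | p.1 ∈ KX C R B z c ∧ p.2 ∈ KX C R B z d ∧ f p.1 = Mev p.2}) := by
  cases d with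
  | none =>
    refine piece_full (T := fun u v => f u = Mev v) hC.2.1 ?_
    intro u hu v hv
    rw [hf u hu, mem_none hz hv]
  | some q =>
    refine piece_empty (T := fun u v => f u = Mev v) ?_
    intro u hu v hv h
    obtain ⟨n, a, g1, g2, g3⟩ := KK_val hB hv
    rw [hf u hu, g1] at h
    exact rep_ne g3 (Option.some.inj h).symm

theorem vertex_piece [Finite E] [Finite I] [Finite Λ] (hC : IsAutomaticStructure C) (hB : 0 < B)
    {z : Tok C R B} (hz : tlab z = zeroT R) (c d : Option (I × Λ)) :
    IsRegularSet (PR {p | p.1 ∈ KX C R B z c ∧ p.2 ∈ KX C R B z d ∧ Mev p.1 = Mev p.2}) := by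
  cases c with
  | none => exact piece_zero hC hB hz (fun u hu => mem_none hz hu) d
  | some q =>
    obtain ⟨i, mu⟩ := q
    refine piece_rep (i' := i) (mu' := mu) hC hB hz (relVertex C (R.G mu)) (PR_of_sync (hC.2.2.2 _)) ?_ d
    intro u hu
    obtain ⟨m, a, h1, h2, h3⟩ := KK_val hB hu
    refine ⟨m, a, h1, h3, ?_⟩
    intro v hv
    constructor
    · intro h
      exact h2.symm.trans h.2.2.2
    · intro h
      exact ⟨hu.2.1, hv, hu.2.2.2, h2.trans h⟩

theorem edge_piece [Finite E] [Finite I] [Finite Λ] (hC : IsAutomaticStructure C) (hB : 0 < B)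
    {z : Tok C R B} (hz : tlab z = zeroT R) (t : Tok C R B) (c d : Option (I × Λ)) :
    IsRegularSet (PR {p | p.1 ∈ KX C R B z c ∧ p.2 ∈ KX C R B z d ∧
      Mev (p.1 ++ [t]) = Mev p.2}) := by
  cases c with
  | none =>
    refine piece_zero (f := fun u => Mev (u ++ [t])) hC hB hz (fun u hu => ?_) d
    exact (Mev_snoc (mem_none hz hu) t).trans (congrArg some (none_mul0 _))
  | some q =>
    obtain ⟨i, mu⟩ := q
    have ht : tlab t = zeroT R ∨ ∃ j y nu, Rep (tlab t) j y nu := by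
      rcases tlab t with _ | ⟨⟨j, y, nu⟩, hv⟩
      · exact Or.inl rfl
      · exact Or.inr ⟨j, y, nu, hv, rfl⟩
    rcases ht with ht | ⟨j, y, nu, ht⟩
    · refine piece_zero (f := fun u => Mev (u ++ [t])) hC hB hz (fun u hu => ?_) d
      obtain ⟨m, a, h1, h2, h3⟩ := KK_val hB hu
      refine (Mev_snoc h1 t).trans (congrArg some ?_)
      rw [ht]
      exact mul0_none m
    · rcases hP : R.P mu j with _ | p
      · refine piece_zero (f := fun u => Mev (u ++ [t])) hC hB hz (fun u hu => ?_) d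
        obtain ⟨m, a, h1, h2, h3⟩ := KK_val hB hu
        exact (Mev_snoc h1 t).trans (congrArg some (rep_mul_zero h3 ht hP))
      · obtain ⟨l, hl, hlv⟩ := C.K_onto (S.mul p y)
        have hpy : S.tgt p = S.src y := by
          obtain ⟨hv, -⟩ := ht
          rw [R.P_tgt _ _ _ hP]
          exact hv.1
        refine piece_rep (f := fun u => Mev (u ++ [t])) (i' := i) (mu' := nu) hC hB hz
          (relPath C l) (PR_relPath C hC l (K_ne C hl)) ?_ d
        intro u hu
        obtain ⟨m, a, h1, h2, h3⟩ := KK_val hB hu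
        have hap : S.tgt a = S.src p := by
          obtain ⟨hv, -⟩ := h3
          rw [R.P_src _ _ _ hP]
          exact hv.2
        refine ⟨_, _, Mev_snoc h1 t, rep_mul h3 ht hP, ?_⟩
        intro v hv
        have hp : IsP C (u.flatMap piece ++ l) :=
          (isP_append C h2 hlv).2 ⟨K_isP C hu.2.1, K_isP C hl, by rw [S.src_mul _ _ hpy, hap]⟩
        have hval := val_append_some C hp h2 hlv
        rw [← S.mul_assoc' a p y hap hpy] at hval
        constructor
        · intro h
          exact hval.symm.trans h.2.2.2
        · intro h
          exact ⟨hu.2.1, hv, hp, hval.trans h⟩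

end fin
end Pf

/-- Corollary 4.5: an explicit sufficient condition for a Rees matrix semigroup
with zero over a semigroupoid to be automatic. -/
theorem stmt_9 {O A I Λ : Type} (S : Sgpd O A) (hne : Nonempty A)
    (hiso : IsolationFree S.toPreSgpd)
    (R : Rees.Data0 S I Λ)
    (hI : Finite I) (hΛ : Finite Λ)
    (hS : IsAutomatic S.toPreSgpd)
    (hcof : { a : A | a ∉ Rees.SPS0 S R }.Finite) :
    IsAutomatic (Rees.pre0 S R) := by
  obtain ⟨E, C, hC⟩ := hS
  have hE : Finite E := hC.1
  obtain ⟨a0⟩ := hne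
  obtain ⟨i0, -⟩ := R.F_onto a0
  obtain ⟨mu0, -⟩ := R.G_onto a0
  obtain ⟨B, hB, hblk⟩ := Pf.exists_block C R hC.2.1 hcof
  have hz := Pf.zt_lab (C := C) (R := R) (B := B) i0 mu0
  refine ⟨_, Pf.CC hB hblk (Pf.zt C R B i0 mu0) hz, inferInstance, ?_, ?_, ?_⟩
  · exact Pf.reg_iUnion (fun c => Pf.KX_reg hC.2.1 _ c)
  · intro t
    refine Pf.sync_pieces (T := fun u v => Pf.Mev (u ++ [t]) = Pf.Mev v) ?_
      (fun c d => Pf.edge_piece hC hB hz t c d)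
    intro u v
    refine ⟨fun h => ⟨h.1, h.2.1, h.2.2.2⟩, fun h => ⟨h.1, h.2.1, ?_, h.2.2⟩⟩
    obtain ⟨c, hc⟩ := Set.mem_iUnion.1 h.1
    show u.getLast?.map _ = some ()
    rw [List.getLast?_eq_some_getLast (Pf.KX_ne hc)]
    rfl
  · rintro ⟨⟩
    refine Pf.sync_pieces (T := fun u v => Pf.Mev u = Pf.Mev v) ?_
      (fun c d => Pf.vertex_piece hC hB hz c d)
    intro u v
    refine ⟨fun h => ⟨h.1, h.2.1, h.2.2.2⟩, fun h => ⟨h.1, h.2.1, ?_, h.2.2⟩⟩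
    obtain ⟨c, hc⟩ := Set.mem_iUnion.1 h.1
    show u.getLast?.map _ = some ()
    rw [List.getLast?_eq_some_getLast (Pf.KX_ne hc)]
    rfl

end AutoRees
end
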